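/- arXiv:2003.10708 — 3 statements merged into one kernel-verified Lean document; each statement's English description precedes it below -/
import Mathlib

section
/- Let m ≥ 1 and let 𝔤 be a real Lie algebra of dimension 4m with complex structure J admitting a basis α₁, …, α_{2m} of (𝔤^{1,0})* satisfying dα_i = 0 for 1 ≤ i ≤ 2m−1 and dα_{2m} = (1/2) Σ_{i=1}^{2m−1} α_i ∧ ᾱ_i. Let θ = t(α_{2m} + ᾱ_{2m}) + Σ_{i=1}^{2m−1} t_i (α_i + ᾱ_i) with t > 0 and t_i ∈ ℝ. Then there is no nondegenerate (2,0)-form ω on 𝔤 (i.e. ω = Σ_{i<j} A_{ij} α_i ∧ α_j with the skew-symmetric complex matrix (A_{ij}) invertible) such that dω = θ ∧ ω. (This is the Lie-algebra content of: on a compact complex nilmanifold with left-invariant complex structure there exists no left-invariant nondegenerate (2,0)-form ω with dω = θ ∧ ω, where θ is the Lee form of a left-invariant lcK metric; it implies that a compact complex nilmanifold carries no left-invariant locally conformally hyperKähler structure.) -/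
open scoped BigOperators

/-- The strictly increasing enumeration of `Fin N` avoiding the two indices `a < b`. -/
def skipTwo {N : ℕ} (a b : ℕ) (t : Fin (N - 2)) : Fin N :=
  ⟨if (t : ℕ) < a then (t : ℕ) else if (t : ℕ) + 1 < b then (t : ℕ) + 1 else (t : ℕ) + 2,
    by have := t.isLt; split_ifs <;> omega⟩

/-- The Chevalley–Eilenberg differential of a (raw) `p`-form on a Lie algebra. -/
noncomputable def ceD {g : Type} [LieRing g] [LieAlgebra ℝ g] {p : ℕ}
    (η : (Fin p → g) → ℂ) : (Fin (p + 1) → g) → ℂ :=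
  fun X => ∑ i : Fin (p + 1), ∑ j : Fin (p + 1),
    if hij : (i : ℕ) < (j : ℕ) then
      (-1 : ℂ) ^ ((i : ℕ) + (j : ℕ)) *
        η (fun t => if ht : (t : ℕ) = 0 then ⁅X i, X j⁆
            else X (skipTwo (N := p + 1) (i : ℕ) (j : ℕ)
              ⟨(t : ℕ) - 1, by have := t.isLt; omega⟩))
    else 0

/-- The wedge product of a (raw) `p`-form and a (raw) `q`-form. -/
noncomputable def wedge {g : Type} [LieRing g] [LieAlgebra ℝ g] {p q : ℕ}
    (α : (Fin p → g) → ℂ) (β : (Fin q → g) → ℂ) : (Fin (p + q) → g) → ℂ :=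
  fun X => ((p.factorial : ℂ) * (q.factorial : ℂ))⁻¹ *
    ∑ σ : Equiv.Perm (Fin (p + q)),
      ((Equiv.Perm.sign σ : ℤ) : ℂ) *
        α (fun i => X (σ (Fin.castAdd q i))) * β (fun i => X (σ (Fin.natAdd p i)))

/-- The `k`-th wedge power of a (raw) `2`-form. -/
noncomputable def wpow {g : Type} [LieRing g] [LieAlgebra ℝ g]
    (ω : (Fin 2 → g) → ℂ) (k : ℕ) : (Fin (2 * k) → g) → ℂ :=
  fun X => ((2 : ℂ) ^ k)⁻¹ *
    ∑ σ : Equiv.Perm (Fin (2 * k)),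
      ((Equiv.Perm.sign σ : ℤ) : ℂ) *
        ∏ t : Fin k, ω (fun s => X (σ ⟨2 * (t : ℕ) + (s : ℕ),
          by have := t.isLt; have := s.isLt; omega⟩))

/-- The action of (the linear extension of) `J` on (raw) `p`-forms:
`(Jη)(X₁, …, X_p) = (−1)^p η(JX₁, …, JX_p)`. -/
noncomputable def Jact {g : Type} [LieRing g] [LieAlgebra ℝ g] (J : g →ₗ[ℝ] g) {p : ℕ}
    (η : (Fin p → g) → ℂ) : (Fin p → g) → ℂ :=
  fun X => (-1 : ℂ) ^ p * η (fun i => J (X i))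

/-- The operator `dᶜ = −J⁻¹ d J` on (raw) `p`-forms, where `J⁻¹ = (−1)^p J` on `p`-forms. -/
noncomputable def dcD {g : Type} [LieRing g] [LieAlgebra ℝ g] (J : g →ₗ[ℝ] g) {p : ℕ}
    (η : (Fin p → g) → ℂ) : (Fin (p + 1) → g) → ℂ :=
  fun X => (-1 : ℂ) ^ p * Jact J (ceD (Jact J η)) X

/-- A linear functional viewed as a raw `1`-form. -/
def oneF {g : Type} [LieRing g] [LieAlgebra ℝ g] (f : g → ℂ) : (Fin 1 → g) → ℂ :=
  fun X => f (X 0)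

/-- Reindexing a raw `a`-form as a `b`-form along a proof `a = b`. -/
def reind {g : Type} [LieRing g] [LieAlgebra ℝ g] {a b : ℕ} (h : a = b)
    (η : (Fin a → g) → ℂ) : (Fin b → g) → ℂ :=
  fun X => η (fun i => X (Fin.cast h i))

/-- The wedge product of a family of `p` raw `1`-forms. -/
noncomputable def wedgeList {g : Type} [LieRing g] [LieAlgebra ℝ g] {p : ℕ}
    (f : Fin p → g → ℂ) : (Fin p → g) → ℂ :=
  fun X => ∑ σ : Equiv.Perm (Fin p), ((Equiv.Perm.sign σ : ℤ) : ℂ) * ∏ t, f t (X (σ t))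

/-- The full coframe `α₁, ᾱ₁, …, α_n, ᾱ_n` as a list of `2n` raw `1`-forms. -/
noncomputable def coframeList {g : Type} [LieRing g] [LieAlgebra ℝ g] (n : ℕ)
    (α : Fin n → (g →ₗ[ℝ] ℂ)) : Fin (2 * n) → g → ℂ :=
  fun t x =>
    if (t : ℕ) % 2 = 0 then α ⟨(t : ℕ) / 2, by have := t.isLt; omega⟩ x
    else (starRingEnd ℂ) (α ⟨(t : ℕ) / 2, by have := t.isLt; omega⟩ x)

/-- The `(n−1, n−1)`-form `m_{i j̄}`: the wedge `α₁ ∧ ᾱ₁ ∧ … ∧ α_n ∧ ᾱ_n` with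
`α_i` and `ᾱ_j` deleted. -/
noncomputable def mForm {g : Type} [LieRing g] [LieAlgebra ℝ g] (n : ℕ)
    (α : Fin n → (g →ₗ[ℝ] ℂ)) (i j : Fin n) : (Fin (2 * n - 2) → g) → ℂ :=
  fun X => wedgeList (fun t =>
    coframeList n α
      (if 2 * (i : ℕ) < 2 * (j : ℕ) + 1
        then skipTwo (N := 2 * n) (2 * (i : ℕ)) (2 * (j : ℕ) + 1) t
        else skipTwo (N := 2 * n) (2 * (j : ℕ) + 1) (2 * (i : ℕ)) t)) X

theorem ceD_oneF_apply {g : Type} [LieRing g] [LieAlgebra ℝ g] (f : g → ℂ) (x y : g) :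
    ceD (oneF f) ![x, y] = -f ⁅x, y⁆ := by
  simp [ceD, oneF, Fin.sum_univ_succ]

theorem ceD_two_apply {g : Type} [LieRing g] [LieAlgebra ℝ g] (W : g → g → ℂ) (x y z : g) :
    ceD (fun v : Fin 2 → g => W (v 0) (v 1)) ![x, y, z] =
      -W ⁅x, y⁆ z + W ⁅x, z⁆ y - W ⁅y, z⁆ x := by
  simp [ceD, skipTwo, Fin.sum_univ_succ]
  ring

theorem wedge_oneF_oneF {g : Type} [LieRing g] [LieAlgebra ℝ g] (f h : g → ℂ)
    (v : Fin 2 → g) :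
    wedge (oneF f) (oneF h) v = f (v 0) * h (v 1) - f (v 1) * h (v 0) := by
  simp [wedge, oneF, Finset.univ_perm_fin_succ, ← Finset.univ_product_univ,
    Fin.sum_univ_succ]
  ring

theorem wedge_oneF_two {g : Type} [LieRing g] [LieAlgebra ℝ g] (f : g → ℂ)
    (W : g → g → ℂ) (hW : ∀ x y, W x y = -W y x) (x y z : g) :
    wedge (oneF f) (fun v : Fin 2 → g => W (v 0) (v 1)) ![x, y, z] =
      f x * W y z - f y * W x z + f z * W x y := by
  have h0 : Equiv.Perm.decomposeFin.symm ((0 : Fin 3), Equiv.swap (0 : Fin 2) 1) 2 = 1 := by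
    decide
  have h1 : Equiv.Perm.decomposeFin.symm ((1 : Fin 3), Equiv.swap (0 : Fin 2) 1) 2 = 0 := by
    decide
  have h2 : Equiv.Perm.decomposeFin.symm ((2 : Fin 3), Equiv.swap (0 : Fin 2) 1) 2 = 1 := by
    decide
  have h3 : Equiv.swap (0 : Fin 3) 1 2 = 2 := by decide
  have h4 : Equiv.swap (0 : Fin 3) 2 1 = 1 := by decide
  simp [wedge, oneF, Finset.univ_perm_fin_succ, ← Finset.univ_product_univ,
    Finset.sum_product, Fin.sum_univ_succ, h0, h1, h2, h3, h4]
  rw [hW z y, hW z x, hW y x]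
  ring

/-- Let `m ≥ 1` and let `𝔤` be a real Lie algebra of dimension `4m` with complex
structure `J` admitting a basis `α₁, …, α_{2m}` of `(𝔤^{1,0})*` with `dαᵢ = 0` for
`1 ≤ i ≤ 2m−1` and `dα_{2m} = (1/2) Σ_{i=1}^{2m−1} αᵢ ∧ ᾱᵢ`.  Let
`θ = t(α_{2m} + ᾱ_{2m}) + Σ tᵢ(αᵢ + ᾱᵢ)` with `t > 0`.  Then there is no nondegenerate
`(2,0)`-form `ω = Σ_{i<j} A_{ij} αᵢ ∧ αⱼ` (with `(A_{ij})` skew-symmetric invertible) such that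
`dω = θ ∧ ω`. -/
theorem statement2 (m : ℕ) (hm : 1 ≤ m)
    (g : Type) [LieRing g] [LieAlgebra ℝ g]
    (J : g →ₗ[ℝ] g)
    (hJ2 : ∀ x, J (J x) = -x)
    (hJi : ∀ x y : g, J ⁅x, y⁆ - ⁅J x, y⁆ - ⁅x, J y⁆ - J ⁅J x, J y⁆ = 0)
    (α : Fin (2 * m) → (g →ₗ[ℝ] ℂ))
    (hα10 : ∀ i x, α i (J x) = Complex.I * α i x)
    (hbasis : Function.Bijective (fun (x : g) (i : Fin (2 * m)) => α i x))
    (hd1 : ∀ i : Fin (2 * m), (i : ℕ) < 2 * m - 1 → ceD (oneF fun x => α i x) = 0)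
    (hd2 : ceD (oneF fun x => α ⟨2 * m - 1, by omega⟩ x) =
      fun v => (1 / 2 : ℂ) * ∑ i : Fin (2 * m - 1),
        wedge (oneF fun x => α (Fin.castLE (by omega) i) x)
          (oneF fun x => (starRingEnd ℂ) (α (Fin.castLE (by omega) i) x)) v)
    (t : ℝ) (ht : 0 < t) (tc : Fin (2 * m - 1) → ℝ) :
    ¬ ∃ (Amat : Matrix (Fin (2 * m)) (Fin (2 * m)) ℂ) (ω : (Fin 2 → g) → ℂ),
      Amat.transpose = -Amat ∧ Amat.det ≠ 0 ∧
      ω = (fun v => ∑ i : Fin (2 * m), ∑ j : Fin (2 * m),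
        if (i : ℕ) < (j : ℕ) then
          Amat i j * wedge (oneF fun x => α i x) (oneF fun x => α j x) v
        else 0) ∧
      ceD ω = wedge
        (oneF fun x =>
          (t : ℂ) * (α ⟨2 * m - 1, by omega⟩ x + (starRingEnd ℂ) (α ⟨2 * m - 1, by omega⟩ x)) +
          ∑ i : Fin (2 * m - 1), (tc i : ℂ) *
            (α (Fin.castLE (by omega) i) x + (starRingEnd ℂ) (α (Fin.castLE (by omega) i) x)))
        ω := by
  rintro ⟨A, ω, hA, hdet, hω, hd⟩
  set n : Fin (2 * m) := ⟨2 * m - 1, by omega⟩ with hn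
  set W : g → g → ℂ := fun x y => ∑ i : Fin (2 * m), ∑ j : Fin (2 * m),
    if (i : ℕ) < (j : ℕ) then A i j * (α i x * α j y - α i y * α j x) else 0 with hW
  have hωW : ω = fun v => W (v 0) (v 1) := by
    rw [hω]
    funext v
    simp only [hW, wedge_oneF_oneF]
  have hWanti : ∀ x y, W x y = -W y x := by
    intro x y
    simp only [hW, ← Finset.sum_neg_distrib]
    refine Finset.sum_congr rfl fun i _ => Finset.sum_congr rfl fun j _ => ?_
    split_ifs <;> ring
  have hWJ : ∀ x y, W (J x) y = Complex.I * W x y := by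
    intro x y
    simp only [hW, Finset.mul_sum, hα10]
    refine Finset.sum_congr rfl fun i _ => Finset.sum_congr rfl fun j _ => ?_
    split_ifs <;> ring
  have hWzero : ∀ y, W 0 y = 0 := by
    intro y
    simp [hW]
  have hWd : ∀ i j : Fin (2 * m), i < j → ∀ x y : g, (∀ k, α k x = if k = i then 1 else 0) →
      (∀ k, α k y = if k = j then 1 else 0) → W x y = A i j := by
    intro i j hij x y hx hy
    simp only [hW, hx, hy]
    rw [Finset.sum_eq_single i, Finset.sum_eq_single j]
    · simp [hij, hij.ne, hij.ne']
    · intro b _ hb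
      simp [hb, hij.ne]
    · simp
    · intro b _ hb
      refine Finset.sum_eq_zero fun c _ => ?_
      rw [ite_eq_right_iff]
      intro hbc
      by_cases hbj : b = j
      · have : c ≠ i := by
          rintro rfl
          subst hbj
          exact absurd hij (not_lt.mpr (le_of_lt hbc))
        simp [hb, this]
      · simp [hb, hbj]
    · simp
  have hbr : ∀ z : g, (∀ i : Fin (2 * m), i ≠ n → α i z = 0) → ∀ x : g, ⁅z, x⁆ = 0 := by
    intro z hz x
    apply hbasis.1
    funext i
    simp only [map_zero]
    by_cases hi : i = n
    · have h := congrFun hd2 ![z, x]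
      rw [ceD_oneF_apply] at h
      have hz' : ∀ k : Fin (2 * m - 1), α (Fin.castLE (by omega) k) z = 0 := fun k =>
        hz _ fun h => by
          have := congrArg Fin.val h
          have := k.isLt
          simp [hn] at *
          omega
      simp only [wedge_oneF_oneF] at h
      simpa [hz', hi] using h
    · have h := congrFun (hd1 i (by
        have := i.isLt
        have : (i : ℕ) ≠ 2 * m - 1 := fun h => hi (Fin.ext h)
        omega)) ![z, x]
      rw [ceD_oneF_apply] at h
      simpa using h
  obtain ⟨z, hz⟩ := hbasis.2 fun k => if k = n then 1 else 0
  replace hz : ∀ k, α k z = if k = n then 1 else 0 := fun k => congrFun hz k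
  have hz0 : ∀ i : Fin (2 * m), i ≠ n → α i z = 0 := fun i hi => by simp [hz, hi]
  have hbz := hbr z hz0
  have hbJz := hbr (J z) fun i hi => by simp [hα10, hz0 i hi]
  have hcast : ∀ k : Fin (2 * m - 1), α (Fin.castLE (by omega) k) z = 0 := fun k =>
    hz0 _ fun h => by
      have := congrArg Fin.val h
      have := k.isLt
      simp [hn] at *
      omega
  have hW0 : ∀ x y, W x y = 0 := by
    intro x y
    rw [hωW] at hd
    set θ : g → ℂ := fun x => (t : ℂ) * (α n x + (starRingEnd ℂ) (α n x)) +
      ∑ i : Fin (2 * m - 1), (tc i : ℂ) *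
        (α (Fin.castLE (by omega) i) x + (starRingEnd ℂ) (α (Fin.castLE (by omega) i) x))
      with hθ
    have hθz : θ z = 2 * t := by
      simp [hθ, hcast, hz n]
      ring
    have hθJz : θ (J z) = 0 := by
      simp [hθ, hα10, hcast, hz n]
    have h1 := congrFun hd ![z, x, y]
    have h2 := congrFun hd ![J z, x, y]
    erw [ceD_two_apply, wedge_oneF_two _ _ hWanti] at h1 h2
    rw [hbz, hbz, hWzero, hWzero, hWanti _ z, hθz] at h1
    rw [hbJz, hbJz, hWzero, hWzero, hWanti _ (J z), hθJz, hWJ, hWJ, hWJ] at h2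
    have h3 : (t : ℂ) * W x y = 0 := by
      have h4 : W z ⁅x, y⁆ = -(θ x * W z y) + θ y * W z x :=
        mul_left_cancel₀ Complex.I_ne_zero (by linear_combination h2)
      linear_combination (1 / 2 : ℂ) * (h4 - h1)
    exact (mul_eq_zero.mp h3).resolve_left (by exact_mod_cast ht.ne')
  have hlt : ∀ i j, i < j → A i j = 0 := by
    intro i j hij
    obtain ⟨x, hx⟩ := hbasis.2 fun k => if k = i then 1 else 0
    obtain ⟨y, hy⟩ := hbasis.2 fun k => if k = j then 1 else 0
    rw [← hWd i j hij x y (congrFun hx) (congrFun hy), hW0]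
  have hskew : ∀ i j, A j i = -A i j := fun i j => congrFun (congrFun hA i) j
  have hA0 : A = 0 := by
    ext i j
    rcases lt_trichotomy i j with h | rfl | h
    · exact hlt i j h
    · exact self_eq_neg.mp (hskew i i)
    · rw [hskew j i, hlt j i h, neg_zero, Matrix.zero_apply]
  have : Nonempty (Fin (2 * m)) := ⟨n⟩
  exact hdet (by rw [hA0, Matrix.det_zero])
end

section
/- Let 𝔤 be a real Lie algebra of dimension 2n, n ≥ 3, with complex structure J, and let ω be a real 2-form of type (1,1) on 𝔤. Then for every 1 ≤ k ≤ n−1 the following identity of 2n-forms holds: ddᶜ(ω^k) ∧ ω^{n−k−1} = k (ddᶜω) ∧ ω^{n−2} − k(k−1) (dᶜω) ∧ dω ∧ ω^{n−3}. -/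
open scoped BigOperators

/-- A permutation of `Fin N`, extended to `ℕ` by the identity. -/
def permExt {N : ℕ} (σ : Equiv.Perm (Fin N)) (i : ℕ) : ℕ :=
  if h : i < N then (σ ⟨i, h⟩ : ℕ) else i

section PermExt

variable {N : ℕ}

lemma permExt_of_lt (σ : Equiv.Perm (Fin N)) {i : ℕ} (h : i < N) :
    permExt σ i = (σ ⟨i, h⟩ : ℕ) := dif_pos h

lemma permExt_of_le (σ : Equiv.Perm (Fin N)) {i : ℕ} (h : N ≤ i) : permExt σ i = i :=
  dif_neg (by omega)

lemma permExt_coe (σ : Equiv.Perm (Fin N)) (i : Fin N) : permExt σ i = (σ i : ℕ) :=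
  permExt_of_lt σ i.isLt

lemma permExt_lt (σ : Equiv.Perm (Fin N)) {i : ℕ} (h : i < N) : permExt σ i < N := by
  rw [permExt_of_lt σ h]; exact (σ _).isLt

lemma permExt_mul (σ τ : Equiv.Perm (Fin N)) (i : ℕ) :
    permExt (σ * τ) i = permExt σ (permExt τ i) := by
  by_cases h : i < N
  · rw [permExt_of_lt _ h, permExt_of_lt τ h, permExt_coe]; rfl
  · rw [permExt_of_le _ (by omega), permExt_of_le τ (by omega), permExt_of_le σ (by omega)]

lemma permExt_one (i : ℕ) : permExt (1 : Equiv.Perm (Fin N)) i = i := by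
  unfold permExt; split_ifs <;> rfl

lemma permExt_inv_apply (σ : Equiv.Perm (Fin N)) (i : ℕ) :
    permExt σ⁻¹ (permExt σ i) = i := by
  rw [← permExt_mul, inv_mul_cancel, permExt_one]

lemma permExt_apply_inv (σ : Equiv.Perm (Fin N)) (i : ℕ) :
    permExt σ (permExt σ⁻¹ i) = i := by
  rw [← permExt_mul, mul_inv_cancel, permExt_one]

lemma permExt_injective (σ : Equiv.Perm (Fin N)) : Function.Injective (permExt σ) :=
  Function.LeftInverse.injective (permExt_inv_apply σ)

lemma permExt_swap (a b : Fin N) (i : ℕ) :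
    permExt (Equiv.swap a b) i = if i = a then (b : ℕ) else if i = b then (a : ℕ) else i := by
  by_cases h : i < N
  · rw [permExt_of_lt _ h, Equiv.swap_apply_def]
    simp only [Fin.ext_iff]
    split_ifs <;> rfl
  · rw [permExt_of_le _ (by omega), if_neg (by omega), if_neg (by omega)]

lemma permExt_cycleRange (a : Fin N) (i : ℕ) :
    permExt a.cycleRange i = if i < a then i + 1 else if i = a then 0 else i := by
  by_cases h : i < N
  · rw [permExt_of_lt _ h]
    split_ifs with h1 h2
    · exact Fin.coe_cycleRange_of_lt (i := ⟨i, h⟩) (j := a) h1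
    · rw [Fin.coe_cycleRange_of_le (i := ⟨i, h⟩) (j := a) (by simp [h2]),
        if_pos (Fin.ext h2)]
    · rw [Fin.cycleRange_of_gt (i := a) (j := ⟨i, h⟩) (by simp [Fin.lt_def]; omega)]
  · rw [permExt_of_le _ (by omega), if_neg (by omega), if_neg (by omega)]

/-- A permutation of the first `p` indices, as a permutation of the first `p + q`. -/
def permLeft {p : ℕ} (q : ℕ) (σ : Equiv.Perm (Fin p)) : Equiv.Perm (Fin (p + q)) :=
  finSumFinEquiv.permCongr (Equiv.Perm.sumCongr σ 1)

/-- A permutation of the last `q` indices, as a permutation of the first `p + q`. -/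
def permRight (p : ℕ) {q : ℕ} (σ : Equiv.Perm (Fin q)) : Equiv.Perm (Fin (p + q)) :=
  finSumFinEquiv.permCongr (Equiv.Perm.sumCongr 1 σ)

lemma sign_permLeft {p : ℕ} (q : ℕ) (σ : Equiv.Perm (Fin p)) :
    Equiv.Perm.sign (permLeft q σ) = Equiv.Perm.sign σ := by
  rw [permLeft, Equiv.Perm.sign_permCongr, Equiv.Perm.sign_sumCongr, map_one, mul_one]

lemma sign_permRight (p : ℕ) {q : ℕ} (σ : Equiv.Perm (Fin q)) :
    Equiv.Perm.sign (permRight p σ) = Equiv.Perm.sign σ := by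
  rw [permRight, Equiv.Perm.sign_permCongr, Equiv.Perm.sign_sumCongr, map_one, one_mul]

lemma permExt_permLeft {p : ℕ} (q : ℕ) (σ : Equiv.Perm (Fin p)) (i : ℕ) :
    permExt (permLeft q σ) i = permExt σ i := by
  rcases lt_or_ge i p with h | h
  · have : (⟨i, by omega⟩ : Fin (p + q)) = Fin.castAdd q ⟨i, h⟩ := rfl
    rw [permExt_of_lt _ h, permExt_of_lt _ (show i < p + q by omega), this, permLeft,
      Equiv.permCongr_apply, finSumFinEquiv_symm_apply_castAdd]
    rfl
  · rw [permExt_of_le σ h]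
    rcases lt_or_ge i (p + q) with h' | h'
    · have : (⟨i, by omega⟩ : Fin (p + q)) = Fin.natAdd p ⟨i - p, by omega⟩ := by
        ext; simp; omega
      rw [permExt_of_lt _ h', this, permLeft,
        Equiv.permCongr_apply, finSumFinEquiv_symm_apply_natAdd]
      simp
      omega
    · rw [permExt_of_le _ h']

lemma permExt_permRight_of_lt {p q : ℕ} (σ : Equiv.Perm (Fin q)) {i : ℕ} (h : i < p) :
    permExt (permRight p σ) i = i := by
  have : (⟨i, by omega⟩ : Fin (p + q)) = Fin.castAdd q ⟨i, h⟩ := rfl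
  rw [permExt_of_lt _ (show i < p + q by omega), this, permRight,
    Equiv.permCongr_apply, finSumFinEquiv_symm_apply_castAdd]
  rfl

lemma permExt_permRight_add (p : ℕ) {q : ℕ} (σ : Equiv.Perm (Fin q)) (i : ℕ) :
    permExt (permRight p σ) (p + i) = p + permExt σ i := by
  rcases lt_or_ge i q with h | h
  · have : (⟨p + i, by omega⟩ : Fin (p + q)) = Fin.natAdd p ⟨i, h⟩ := rfl
    rw [permExt_of_lt _ h, permExt_of_lt _ (show p + i < p + q by omega), this, permRight,
      Equiv.permCongr_apply, finSumFinEquiv_symm_apply_natAdd]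
    rfl
  · rw [permExt_of_le _ (by omega), permExt_of_le _ h]

/-- A permutation fixing every index below `p` shifts down by `p`. -/
lemma exists_permRight_eq {p q : ℕ} (σ : Equiv.Perm (Fin (p + q)))
    (h : ∀ i, i < p → permExt σ i = i) : ∃ τ : Equiv.Perm (Fin q), permRight p τ = σ := by
  have hge : ∀ σ : Equiv.Perm (Fin (p + q)), (∀ i, i < p → permExt σ i = i) →
      ∀ i, p ≤ permExt σ (p + i) := by
    intro σ h i
    by_contra! hc
    have := permExt_injective σ (h _ hc)
    omega
  have h' : ∀ i, i < p → permExt σ⁻¹ i = i := by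
    intro i hi
    conv_lhs => rw [← h i hi]
    exact permExt_inv_apply σ i
  refine ⟨⟨fun i => ⟨permExt σ (p + i) - p, ?_⟩, fun i => ⟨permExt σ⁻¹ (p + i) - p, ?_⟩,
    ?_, ?_⟩, ?_⟩
  · have := permExt_lt σ (show p + (i : ℕ) < p + q by omega); have := hge σ h i; omega
  · have := permExt_lt σ⁻¹ (show p + (i : ℕ) < p + q by omega); have := hge _ h' i; omega
  · intro i
    ext
    simp only
    rw [Nat.add_sub_cancel' (hge σ h i), permExt_inv_apply, Nat.add_sub_cancel_left]
  · intro i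
    ext
    simp only
    rw [Nat.add_sub_cancel' (hge _ h' i), permExt_apply_inv, Nat.add_sub_cancel_left]
  · ext i
    rw [← permExt_coe, ← permExt_coe]
    rcases lt_or_ge (i : ℕ) p with hi | hi
    · rw [permExt_permRight_of_lt _ hi, h _ hi]
    · obtain ⟨j, hj⟩ := Nat.exists_eq_add_of_le hi
      rw [hj, permExt_permRight_add, permExt_of_lt _ (by omega)]
      simp only [Equiv.coe_fn_mk]
      rw [Nat.add_sub_cancel' (hge σ h j)]

/-- The permutation `0, …, p-1, p, p+1 ↦ 2, …, p+1, 0, 1`. -/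
lemma permExt_cycleRange_sq (a : Fin N) (ha : 1 ≤ (a : ℕ)) (i : ℕ) :
    permExt (a.cycleRange * a.cycleRange) i =
      if i + 1 < a then i + 2 else if i + 1 = a then 0 else if i = a then 1 else i := by
  simp only [permExt_mul, permExt_cycleRange]
  split_ifs <;> omega

end PermExt

section Counting

open Equiv

lemma card_mul_sum_perm_apply {N : ℕ} (a : Fin N) (f : Fin N → ℂ) :
    (N : ℂ) * ∑ σ : Perm (Fin N), f (σ a) = (N.factorial : ℂ) * ∑ i, f i := by
  have key : ∀ b, ∑ σ : Perm (Fin N), f (σ b) = ∑ σ : Perm (Fin N), f (σ a) := by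
    intro b
    rw [← Equiv.sum_comp (Equiv.mulRight (swap a b))]
    simp
  have h1 : ∑ b, ∑ σ : Perm (Fin N), f (σ b) = (N : ℂ) * ∑ σ : Perm (Fin N), f (σ a) := by
    simp [key]
  rw [← h1, Finset.sum_comm]
  simp [Equiv.sum_comp, Fintype.card_perm]

lemma sum_perm_apply_apply {m : ℕ} (f : Fin (m + 2) → Fin (m + 2) → ℂ) (hf : ∀ i, f i i = 0) :
    ∑ σ : Perm (Fin (m + 2)), f (σ 0) (σ 1) = (m.factorial : ℂ) * ∑ i, ∑ j, f i j := by
  obtain ⟨S, hS⟩ : ∃ S, ∑ σ : Perm (Fin (m + 2)), f (σ 0) (σ 1) = S := ⟨_, rfl⟩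
  rw [hS]
  have key : ∀ a b : Fin (m + 2), ∑ σ : Perm (Fin (m + 2)), f (σ a) (σ b) =
      if a = b then 0 else S := by
    intro a b
    split_ifs with hab
    · simp [hab, hf]
    · have hb : swap 0 a b ≠ 0 := by
        intro h
        apply hab
        have := congrArg (swap 0 a) h
        simpa using this.symm
      rw [← Equiv.sum_comp (Equiv.mulRight (swap 0 a * swap 1 (swap 0 a b))⁻¹)]
      rw [← hS]
      refine Finset.sum_congr rfl fun σ _ => ?_
      congr 1
      · simp [Perm.mul_apply, swap_apply_of_ne_of_ne (x := (0 : Fin (m + 2))) zero_ne_one hb.symm]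
      · simp [Perm.mul_apply]
  have h1 : ∑ a, ∑ b, ∑ σ : Perm (Fin (m + 2)), f (σ a) (σ b) =
      ((m + 2 : ℕ) : ℂ) * ((m + 1 : ℕ) : ℂ) * S := by
    simp only [key]
    have : ∀ a : Fin (m + 2), ∑ b : Fin (m + 2),
        (if a = b then 0 else S) =
        ((m + 1 : ℕ) : ℂ) * S := by
      intro a
      rw [Fin.sum_univ_succAbove _ a]
      simp [(Fin.succAbove_ne a _).symm]
    simp only [this]
    rw [Finset.sum_const, Finset.card_univ, Fintype.card_fin, nsmul_eq_mul, mul_assoc]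
  have h2 : ∑ a, ∑ b, ∑ σ : Perm (Fin (m + 2)), f (σ a) (σ b) =
      ((m + 2).factorial : ℂ) * ∑ i, ∑ j, f i j := by
    rw [Finset.sum_congr rfl fun a _ => Finset.sum_comm, Finset.sum_comm]
    have : ∀ σ : Perm (Fin (m + 2)), ∑ a, ∑ b, f (σ a) (σ b) = ∑ i, ∑ j, f i j := by
      intro σ
      rw [← Equiv.sum_comp σ (fun i => ∑ j, f i j)]
      exact Finset.sum_congr rfl fun a _ => Equiv.sum_comp σ (fun j => f (σ a) j)
    simp [this, Fintype.card_perm]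
  rw [h1, Nat.factorial_succ, Nat.factorial_succ] at h2
  have h3 : ((m + 2 : ℕ) : ℂ) * ((m + 1 : ℕ) : ℂ) ≠ 0 :=
    mul_ne_zero (Nat.cast_ne_zero.mpr (by omega)) (Nat.cast_ne_zero.mpr (by omega))
  apply mul_left_cancel₀ h3
  rw [h2]
  push_cast
  ring

lemma sum_perm_apply_zero_one {N m : ℕ} (hN : N = 2 + m) (f : Fin N → Fin N → ℂ)
    (hf : ∀ i, f i i = 0) :
    ∑ σ : Perm (Fin N), f (σ ⟨0, by omega⟩) (σ ⟨1, by omega⟩) =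
      (m.factorial : ℂ) * ∑ i, ∑ j, f i j := by
  obtain rfl : N = m + 2 := by omega
  exact sum_perm_apply_apply f hf

end Counting

section SequenceForms

open Equiv

/-- The sum of the signed permutations, in the first `N` arguments, of a function of sequences. -/
noncomputable def asum {g : Type} (N : ℕ) (F : (ℕ → g) → ℂ) : (ℕ → g) → ℂ :=
  fun X => ∑ σ : Perm (Fin N), ((Perm.sign σ : ℤ) : ℂ) * F (fun i => X (permExt σ i))

/-- The tensor product of a function of the first `p` arguments and another function. -/
def tens {g : Type} (p : ℕ) (F G : (ℕ → g) → ℂ) : (ℕ → g) → ℂ :=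
  fun X => F X * G (fun i => X (p + i))

/-- The wedge product, for forms seen as functions of sequences. -/
noncomputable def swedge {g : Type} (p q : ℕ) (F G : (ℕ → g) → ℂ) : (ℕ → g) → ℂ :=
  fun X => ((p.factorial : ℂ) * (q.factorial : ℂ))⁻¹ * asum (p + q) (tens p F G) X

/-- Replace the first two arguments of a sequence by their bracket. -/
def bracSeq {g : Type} [LieRing g] (X : ℕ → g) : ℕ → g :=
  fun i => if i = 0 then ⁅X 0, X 1⁆ else X (i + 1)

/-- `F` evaluated after bracketing the first two arguments. -/
def brac {g : Type} [LieRing g] (F : (ℕ → g) → ℂ) : (ℕ → g) → ℂ :=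
  fun X => F (bracSeq X)

/-- `F` depends only on the first `p` arguments. -/
def DepOn {g : Type} (p : ℕ) (F : (ℕ → g) → ℂ) : Prop :=
  ∀ X Y : ℕ → g, (∀ i, i < p → X i = Y i) → F X = F Y

/-- `F` is antisymmetric in the first `p` arguments. -/
def AntisymmOn {g : Type} (p : ℕ) (F : (ℕ → g) → ℂ) : Prop :=
  ∀ (σ : Perm (Fin p)) (X : ℕ → g),
    F (fun i => X (permExt σ i)) = ((Perm.sign σ : ℤ) : ℂ) * F X

/-- `F` is odd in each of the first `p` arguments. -/
def OddOn {g : Type} [LieRing g] (p : ℕ) (F : (ℕ → g) → ℂ) : Prop :=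
  ∀ j, j < p → ∀ X : ℕ → g, F (Function.update X j (-X j)) = -F X

/-- The properties of a `p`-form, seen as a function of sequences, that its exterior calculus
uses. -/
structure IsSeqForm {g : Type} [LieRing g] (p : ℕ) (F : (ℕ → g) → ℂ) : Prop where
  dep : DepOn p F
  antisymm : AntisymmOn p F
  odd : OddOn p F

lemma sign_mul_sign_cast {N : ℕ} (σ : Perm (Fin N)) :
    ((Perm.sign σ : ℤ) : ℂ) * ((Perm.sign σ : ℤ) : ℂ) = 1 := by
  rw [← Int.cast_mul, ← Units.val_mul, Int.units_mul_self]; simp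

lemma sign_mul_cast {N : ℕ} (σ τ : Perm (Fin N)) :
    ((Perm.sign (σ * τ) : ℤ) : ℂ) = ((Perm.sign σ : ℤ) : ℂ) * ((Perm.sign τ : ℤ) : ℂ) := by
  rw [Perm.sign_mul, Units.val_mul, Int.cast_mul]

section Asum

variable {g : Type}

lemma asum_comp {N : ℕ} (τ : Perm (Fin N)) (F : (ℕ → g) → ℂ) (X : ℕ → g) :
    asum N (fun Y => F (fun i => Y (permExt τ i))) X = ((Perm.sign τ : ℤ) : ℂ) * asum N F X := by
  unfold asum
  rw [← Equiv.sum_comp (Equiv.mulRight τ)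
    (fun σ => ((Perm.sign σ : ℤ) : ℂ) * F (fun i => X (permExt σ i))), Finset.mul_sum]
  refine Finset.sum_congr rfl fun σ _ => ?_
  simp only [Equiv.coe_mulRight, permExt_mul, sign_mul_cast]
  linear_combination -(((Perm.sign σ : ℤ) : ℂ) *
    F (fun i => X (permExt σ (permExt τ i)))) * sign_mul_sign_cast τ

lemma antisymmOn_asum (N : ℕ) (F : (ℕ → g) → ℂ) : AntisymmOn N (asum N F) := by
  intro τ X
  unfold asum
  rw [← Equiv.sum_comp (Equiv.mulLeft τ)
    (fun σ => ((Perm.sign σ : ℤ) : ℂ) * F (fun i => X (permExt σ i))), Finset.mul_sum]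
  refine Finset.sum_congr rfl fun σ _ => ?_
  simp only [Equiv.coe_mulLeft, permExt_mul, sign_mul_cast]
  linear_combination -(((Perm.sign σ : ℤ) : ℂ) *
    F (fun i => X (permExt τ (permExt σ i)))) * sign_mul_sign_cast τ

lemma asum_const_mul (N : ℕ) (c : ℂ) (F : (ℕ → g) → ℂ) :
    asum N (fun X => c * F X) = fun X => c * asum N F X := by
  funext X
  unfold asum
  rw [Finset.mul_sum]
  exact Finset.sum_congr rfl fun σ _ => by ring

lemma asum_add (N : ℕ) (F G : (ℕ → g) → ℂ) :
    asum N (fun X => F X + G X) = fun X => asum N F X + asum N G X := by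
  funext X
  unfold asum
  rw [← Finset.sum_add_distrib]
  exact Finset.sum_congr rfl fun σ _ => by ring

lemma asum_sum (N : ℕ) {ι : Type*} (s : Finset ι) (F : ι → (ℕ → g) → ℂ) (X : ℕ → g) :
    asum N (fun X => ∑ i ∈ s, F i X) X = ∑ i ∈ s, asum N (F i) X := by
  unfold asum
  rw [Finset.sum_comm]
  exact Finset.sum_congr rfl fun σ _ => Finset.mul_sum _ _ _

lemma DepOn.asum {N : ℕ} {F : (ℕ → g) → ℂ} (hF : DepOn N F) : DepOn N (asum N F) := by
  intro X Y h
  refine Finset.sum_congr rfl fun σ _ => ?_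
  rw [hF _ _ fun i hi => h _ (permExt_lt σ hi)]

lemma DepOn.tens {p q : ℕ} {F G : (ℕ → g) → ℂ} (hF : DepOn p F) (hG : DepOn q G) :
    DepOn (p + q) (tens p F G) := by
  intro X Y h
  unfold _root_.tens
  rw [hF X Y fun i hi => h i (by omega), hG _ _ fun i hi => h (p + i) (by omega)]

/-- Antisymmetrizing the left factor beforehand multiplies the antisymmetrization by `p!`. -/
lemma asum_tens_asum_left (p q : ℕ) (F G : (ℕ → g) → ℂ) :
    asum (p + q) (tens p (asum p F) G) =
      fun X => (p.factorial : ℂ) * asum (p + q) (tens p F G) X := by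
  have h : tens p (asum p F) G = fun X => ∑ σ : Perm (Fin p), ((Perm.sign σ : ℤ) : ℂ) *
      tens p F G (fun i => X (permExt (permLeft q σ) i)) := by
    funext X
    unfold tens asum
    rw [Finset.sum_mul]
    refine Finset.sum_congr rfl fun σ _ => ?_
    simp only [permExt_permLeft]
    rw [mul_assoc]
    congr! 4
    rw [permExt_of_le σ (by omega)]
  funext X
  rw [h, asum_sum]
  simp only [asum_const_mul, asum_comp, sign_permLeft, ← mul_assoc, sign_mul_sign_cast, one_mul]
  simp [Fintype.card_perm]

/-- Antisymmetrizing the right factor beforehand multiplies the antisymmetrization by `q!`. -/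
lemma asum_tens_asum_right (p q : ℕ) {F : (ℕ → g) → ℂ} (hF : DepOn p F) (G : (ℕ → g) → ℂ) :
    asum (p + q) (tens p F (asum q G)) =
      fun X => (q.factorial : ℂ) * asum (p + q) (tens p F G) X := by
  have h : tens p F (asum q G) = fun X => ∑ σ : Perm (Fin q), ((Perm.sign σ : ℤ) : ℂ) *
      tens p F G (fun i => X (permExt (permRight p σ) i)) := by
    funext X
    unfold tens asum
    rw [Finset.mul_sum]
    refine Finset.sum_congr rfl fun σ _ => ?_
    rw [hF (fun i => X (permExt (permRight p σ) i)) X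
      fun i hi => by rw [permExt_permRight_of_lt σ hi]]
    simp only [permExt_permRight_add]
    ring
  funext X
  rw [h, asum_sum]
  simp only [asum_const_mul, asum_comp, sign_permRight, ← mul_assoc, sign_mul_sign_cast, one_mul]
  simp [Fintype.card_perm]

lemma tens_const_mul_left (p : ℕ) (c : ℂ) (F G : (ℕ → g) → ℂ) :
    tens p (fun X => c * F X) G = fun X => c * tens p F G X := by
  funext X; unfold tens; ring

lemma tens_const_mul_right (p : ℕ) (c : ℂ) (F G : (ℕ → g) → ℂ) :
    tens p F (fun X => c * G X) = fun X => c * tens p F G X := by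
  funext X; unfold tens; ring

lemma tens_add_left (p : ℕ) (F F' G : (ℕ → g) → ℂ) :
    tens p (fun X => F X + F' X) G = fun X => tens p F G X + tens p F' G X := by
  funext X; unfold tens; ring

lemma tens_assoc (p q : ℕ) (F G H : (ℕ → g) → ℂ) :
    tens (p + q) (tens p F G) H = tens p F (tens q G H) := by
  funext X; unfold tens; simp only [mul_assoc, add_assoc]

lemma swedge_const_mul_left (p q : ℕ) (c : ℂ) (F G : (ℕ → g) → ℂ) :
    swedge p q (fun X => c * F X) G = fun X => c * swedge p q F G X := by
  funext X; unfold swedge; rw [tens_const_mul_left, asum_const_mul]; ring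

lemma swedge_const_mul_right (p q : ℕ) (c : ℂ) (F G : (ℕ → g) → ℂ) :
    swedge p q F (fun X => c * G X) = fun X => c * swedge p q F G X := by
  funext X; unfold swedge; rw [tens_const_mul_right, asum_const_mul]; ring

lemma swedge_add_left (p q : ℕ) (F F' G : (ℕ → g) → ℂ) :
    swedge p q (fun X => F X + F' X) G = fun X => swedge p q F G X + swedge p q F' G X := by
  funext X; unfold swedge; rw [tens_add_left, asum_add]; ring

lemma factorial_cast_ne_zero (p : ℕ) : (p.factorial : ℂ) ≠ 0 :=
  Nat.cast_ne_zero.mpr p.factorial_ne_zero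

lemma swedge_assoc (p q r : ℕ) {F : (ℕ → g) → ℂ} (hF : DepOn p F) (G H : (ℕ → g) → ℂ) :
    swedge (p + q) r (swedge p q F G) H = swedge p (q + r) F (swedge q r G H) := by
  funext X
  unfold swedge
  rw [tens_const_mul_left, tens_const_mul_right, asum_const_mul, asum_const_mul,
    asum_tens_asum_left, asum_tens_asum_right p (q + r) hF, tens_assoc, add_assoc]
  have hp := factorial_cast_ne_zero p
  have hq := factorial_cast_ne_zero q
  have hr := factorial_cast_ne_zero r
  have hpq := factorial_cast_ne_zero (p + q)
  have hqr := factorial_cast_ne_zero (q + r)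
  field_simp

lemma asum_of_antisymmOn {N : ℕ} {F : (ℕ → g) → ℂ} (hF : AntisymmOn N F) (X : ℕ → g) :
    asum N F X = (N.factorial : ℂ) * F X := by
  unfold asum
  simp only [hF _ X, ← mul_assoc, sign_mul_sign_cast, one_mul]
  simp [Fintype.card_perm]

lemma one_swedge {q : ℕ} {G : (ℕ → g) → ℂ} (hG : AntisymmOn q G) :
    swedge 0 q (fun _ => 1) G = G := by
  funext X
  have h : tens 0 (fun _ => 1) G = G := by funext Y; simp [tens]
  unfold swedge
  rw [h, zero_add, asum_of_antisymmOn hG]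
  have := factorial_cast_ne_zero q
  simp [this]

lemma swedge_one {p : ℕ} {F : (ℕ → g) → ℂ} (hF : AntisymmOn p F) :
    swedge p 0 F (fun _ => 1) = F := by
  funext X
  have h : tens p F (fun _ => 1) = F := by funext Y; simp [tens]
  unfold swedge
  rw [h, add_zero, asum_of_antisymmOn hF]
  have := factorial_cast_ne_zero p
  simp [this]

/-- Even forms commute: the case of a `2`-form. -/
lemma swedge_two_comm (q : ℕ) {F G : (ℕ → g) → ℂ} (hF : DepOn 2 F) (hG : DepOn q G) :
    swedge 2 q F G = swedge q 2 G F := by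
  funext X
  unfold swedge
  rw [add_comm 2 q, mul_comm (Nat.factorial 2 : ℂ)]
  congr 1
  let a : Fin (q + 2) := ⟨q + 1, by omega⟩
  have h : tens 2 F G =
      fun Y => tens q G F (fun i => Y (permExt (a.cycleRange * a.cycleRange) i)) := by
    funext Y
    unfold tens
    rw [mul_comm]
    congr 1
    · refine hG _ _ fun i hi => ?_
      rw [permExt_cycleRange_sq a (by simp [a]), if_pos (by simp [a, hi]), add_comm]
    · refine hF _ _ fun i hi => ?_
      simp only [permExt_cycleRange_sq a (show 1 ≤ q + 1 by omega)]
      simp only [a]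
      congr 1
      split_ifs <;> omega
  rw [h, asum_comp, sign_mul_cast, sign_mul_sign_cast, one_mul]

end Asum

section Odd

variable {g : Type} [LieRing g]

lemma OddOn.tens {p q : ℕ} {F G : (ℕ → g) → ℂ} (hFd : DepOn p F) (hF : OddOn p F)
    (hG : OddOn q G) : OddOn (p + q) (tens p F G) := by
  intro j hj X
  unfold _root_.tens
  rcases lt_or_ge j p with h | h
  · rw [hF j h]
    have : (fun i => Function.update X j (-X j) (p + i)) = fun i => X (p + i) := by
      funext i; rw [Function.update_of_ne (by omega)]
    rw [this]; ring
  · obtain ⟨k, rfl⟩ := Nat.exists_eq_add_of_le h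
    rw [hFd _ X fun i hi => Function.update_of_ne (by omega) _ _]
    have : (fun i => Function.update X (p + k) (-X (p + k)) (p + i)) =
        Function.update (fun i => X (p + i)) k (-X (p + k)) := by
      funext i
      by_cases hik : i = k
      · subst hik; simp
      · rw [Function.update_of_ne hik, Function.update_of_ne (by omega)]
    rw [this, hG k (by omega) (fun i => X (p + i))]; ring

lemma OddOn.asum {N : ℕ} {F : (ℕ → g) → ℂ} (hF : OddOn N F) : OddOn N (asum N F) := by
  intro j hj X
  unfold _root_.asum
  rw [← Finset.sum_neg_distrib]
  refine Finset.sum_congr rfl fun σ _ => ?_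
  have : (fun i => Function.update X j (-X j) (permExt σ i)) =
      Function.update (fun i => X (permExt σ i)) (permExt σ⁻¹ j)
        (-X (permExt σ (permExt σ⁻¹ j))) := by
    funext i
    rw [permExt_apply_inv]
    by_cases hij : permExt σ i = j
    · subst hij; rw [permExt_inv_apply]; simp
    · rw [Function.update_of_ne hij, Function.update_of_ne]
      rintro rfl
      exact hij (permExt_apply_inv σ j)
  rw [this, hF _ (permExt_lt σ⁻¹ hj) (fun i => X (permExt σ i))]
  ring

lemma OddOn.const_mul {N : ℕ} {F : (ℕ → g) → ℂ} (hF : OddOn N F) (c : ℂ) :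
    OddOn N (fun X => c * F X) := by
  intro j hj X
  simp only [hF j hj X]; ring

lemma bracSeq_update_zero (X : ℕ → g) :
    bracSeq (Function.update X 0 (-X 0)) = Function.update (bracSeq X) 0 (-bracSeq X 0) := by
  funext i
  by_cases hi : i = 0
  · subst hi; simp [bracSeq]
  · simp [bracSeq, hi]

lemma bracSeq_update_succ (X : ℕ → g) (j : ℕ) :
    bracSeq (Function.update X (j + 1) (-X (j + 1))) =
      Function.update (bracSeq X) j (-bracSeq X j) := by
  funext i
  by_cases hi : i = 0
  · subst hi
    by_cases hj : j = 0
    · subst hj; simp [bracSeq]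
    · rw [Function.update_of_ne (Ne.symm hj)]
      simp only [bracSeq, if_true]
      rw [Function.update_of_ne (by omega), Function.update_of_ne (by omega)]
  · by_cases hj : i = j
    · subst hj; simp [bracSeq, hi]
    · rw [Function.update_of_ne hj]
      simp only [bracSeq, if_neg hi]
      rw [Function.update_of_ne (by omega)]

lemma OddOn.brac {p : ℕ} (hp : 1 ≤ p) {F : (ℕ → g) → ℂ} (hF : OddOn p F) :
    OddOn (p + 1) (brac F) := by
  intro j hj X
  unfold _root_.brac
  rcases j with _ | j
  · rw [bracSeq_update_zero, hF 0 hp (bracSeq X)]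
  · rw [bracSeq_update_succ, hF j (by omega) (bracSeq X)]

lemma DepOn.brac {p : ℕ} (hp : 1 ≤ p) {F : (ℕ → g) → ℂ} (hF : DepOn p F) :
    DepOn (p + 1) (brac F) := by
  intro X Y h
  refine hF _ _ fun i hi => ?_
  unfold bracSeq
  rw [h 0 (by omega), h 1 (by omega), h (i + 1) (by omega)]

lemma IsSeqForm.const_mul {p : ℕ} {F : (ℕ → g) → ℂ} (hF : IsSeqForm p F) (c : ℂ) :
    IsSeqForm p (fun X => c * F X) :=
  ⟨fun X Y h => by simp only [hF.dep X Y h], fun σ X => by simp only [hF.antisymm σ X]; ring,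
    hF.odd.const_mul c⟩

lemma isSeqForm_asum {N : ℕ} {F : (ℕ → g) → ℂ} (hd : DepOn N F) (ho : OddOn N F) :
    IsSeqForm N (asum N F) :=
  ⟨hd.asum, antisymmOn_asum N F, ho.asum⟩

lemma IsSeqForm.swedge {p q : ℕ} {F G : (ℕ → g) → ℂ} (hF : IsSeqForm p F)
    (hG : IsSeqForm q G) : IsSeqForm (p + q) (swedge p q F G) :=
  (isSeqForm_asum (hF.dep.tens hG.dep) (OddOn.tens hF.dep hF.odd hG.odd)).const_mul _

end Odd

end SequenceForms

section SequenceDifferential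

open Equiv

/-- The increasing enumeration of the natural numbers other than `a < b`. -/
def skipIdx (a b t : ℕ) : ℕ := if t < a then t else if t + 1 < b then t + 1 else t + 2

/-- Move the bracket of the arguments `a < b` to the front. -/
def pairSeq {g : Type} [LieRing g] (X : ℕ → g) (a b : ℕ) : ℕ → g :=
  fun t => if t = 0 then ⁅X a, X b⁆ else X (skipIdx a b (t - 1))

/-- The Chevalley–Eilenberg differential, for forms seen as functions of sequences. -/
noncomputable def sD {g : Type} [LieRing g] (p : ℕ) (F : (ℕ → g) → ℂ) : (ℕ → g) → ℂ :=
  fun X => ∑ i : Fin (p + 1), ∑ j : Fin (p + 1),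
    if (i : ℕ) < (j : ℕ) then (-1 : ℂ) ^ ((i : ℕ) + (j : ℕ)) * F (pairSeq X i j) else 0

variable {g : Type} [LieRing g]

lemma bracSeq_permRight {m : ℕ} (σ : Perm (Fin m)) (X : ℕ → g) :
    bracSeq (fun i => X (permExt (permRight 2 σ) i)) =
      fun i => bracSeq X (permExt (permRight 1 σ) i) := by
  funext i
  rcases Nat.eq_zero_or_pos i with rfl | hi
  · rw [permExt_permRight_of_lt σ (by omega)]
    simp [bracSeq, permExt_permRight_of_lt σ (show 0 < 2 by omega),
      permExt_permRight_of_lt σ (show 1 < 2 by omega)]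
  · obtain ⟨k, rfl⟩ := Nat.exists_eq_add_of_le hi
    rw [permExt_permRight_add]
    unfold bracSeq
    rw [if_neg (by omega), if_neg (by omega), show 1 + k + 1 = 2 + k by omega]
    beta_reduce
    rw [permExt_permRight_add, show 1 + permExt σ k + 1 = 2 + permExt σ k by omega]

/-- Antisymmetrizing after bracketing: permutations fixing the first argument only contribute
their sign. -/
lemma asum_brac_comp {N : ℕ} (hN : 1 ≤ N) (σ : Perm (Fin N)) (hσ : permExt σ 0 = 0)
    (K : (ℕ → g) → ℂ) :
    asum (N + 1) (brac fun Y => K (fun i => Y (permExt σ i))) =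
      fun X => ((Perm.sign σ : ℤ) : ℂ) * asum (N + 1) (brac K) X := by
  obtain ⟨m, rfl⟩ := Nat.exists_eq_add_of_le hN
  obtain ⟨τ, rfl⟩ := exists_permRight_eq σ fun i hi => by
    rwa [Nat.lt_one_iff.mp hi]
  funext X
  have h : (brac fun Y => K (fun i => Y (permExt (permRight 1 τ) i))) =
      fun Y => brac K (fun i => Y (permExt (permRight 2 τ) i)) := by
    funext Y
    unfold brac
    rw [bracSeq_permRight]
  rw [h, show 1 + m + 1 = 2 + m by omega, asum_comp, sign_permRight, sign_permRight]

section Differential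

/-- The permutation enumerating `a < b` first, and then the other indices increasingly. -/
def frontPerm {N : ℕ} (h : 2 ≤ N) (a b : Fin N) : Perm (Fin N) :=
  (swap ⟨0, by omega⟩ ⟨1, by omega⟩ * b.cycleRange * a.cycleRange)⁻¹

lemma sign_frontPerm {N : ℕ} (h : 2 ≤ N) (a b : Fin N) :
    ((Perm.sign (frontPerm h a b) : ℤ) : ℂ) = -(-1) ^ ((a : ℕ) + (b : ℕ)) := by
  rw [frontPerm, Perm.sign_inv, Perm.sign_mul, Perm.sign_mul, Fin.sign_cycleRange,
    Fin.sign_cycleRange, Perm.sign_swap (by simp)]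
  push_cast
  ring

lemma permExt_frontPerm_inv {N : ℕ} (h : 2 ≤ N) {a b : Fin N} (hab : a < b) (i : ℕ) :
    permExt (frontPerm h a b)⁻¹ i =
      if i < a then i + 2 else if i = a then 0 else if i < b then i + 1
      else if i = b then 1 else i := by
  have hab' : (a : ℕ) < b := hab
  rw [frontPerm, inv_inv, permExt_mul, permExt_mul, permExt_cycleRange a]
  split_ifs <;> rw [permExt_cycleRange b, permExt_swap] <;> simp only <;>
    split_ifs <;> first | omega | contradiction

lemma permExt_frontPerm {N : ℕ} (h : 2 ≤ N) {a b : Fin N} (hab : a < b) (i : ℕ) :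
    permExt (frontPerm h a b) i =
      if i = 0 then (a : ℕ) else if i = 1 then (b : ℕ) else skipIdx a b (i - 2) := by
  apply permExt_injective (frontPerm h a b)⁻¹
  have hab' : (a : ℕ) < b := hab
  rw [permExt_inv_apply, permExt_frontPerm_inv h hab]
  unfold skipIdx
  split_ifs <;> omega

lemma sign_mul_brac_of_lt {m : ℕ} {F : (ℕ → g) → ℂ} (hF : AntisymmOn (1 + m) F)
    (σ : Perm (Fin (2 + m))) (h : permExt σ 0 < permExt σ 1) (X : ℕ → g) :
    ((Perm.sign σ : ℤ) : ℂ) * brac F (fun i => X (permExt σ i)) =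
      -(-1) ^ (permExt σ 0 + permExt σ 1) * F (pairSeq X (permExt σ 0) (permExt σ 1)) := by
  let a : Fin (2 + m) := ⟨permExt σ 0, permExt_lt σ (by omega)⟩
  let b : Fin (2 + m) := ⟨permExt σ 1, permExt_lt σ (by omega)⟩
  have hab : a < b := h
  set ρ := frontPerm (by omega) a b with hρ
  have hρ0 : permExt ρ 0 = permExt σ 0 := by rw [hρ, permExt_frontPerm _ hab, if_pos rfl]
  have hρ1 : permExt ρ 1 = permExt σ 1 := by
    rw [hρ, permExt_frontPerm _ hab, if_neg (by omega), if_pos rfl]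
  obtain ⟨τ, hτ⟩ := exists_permRight_eq (ρ⁻¹ * σ) fun i hi => by
    rw [permExt_mul]
    apply permExt_injective ρ
    rw [permExt_apply_inv]
    interval_cases i
    · exact hρ0.symm
    · exact hρ1.symm
  have hσ : σ = ρ * permRight 2 τ := by rw [hτ, mul_inv_cancel_left]
  have hpair : bracSeq (fun i => X (permExt ρ i)) = pairSeq X a b := by
    funext i
    unfold bracSeq pairSeq
    split_ifs with hi
    · beta_reduce
      rw [hρ0, hρ1]
    · beta_reduce
      rw [hρ, permExt_frontPerm _ hab, if_neg (by omega), if_neg (by omega)]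
      rfl
  have hb : brac F (fun i => X (permExt σ i)) =
      ((Perm.sign τ : ℤ) : ℂ) * F (pairSeq X a b) := by
    unfold brac
    rw [hσ]
    simp only [permExt_mul]
    rw [bracSeq_permRight τ (fun i => X (permExt ρ i)), hpair, hF, sign_permRight]
  have hs : ((Perm.sign σ : ℤ) : ℂ) =
      -(-1) ^ (permExt σ 0 + permExt σ 1) * ((Perm.sign τ : ℤ) : ℂ) := by
    conv_lhs => rw [hσ]
    rw [sign_mul_cast, sign_permRight, hρ, sign_frontPerm]
  rw [hb, hs]
  linear_combination (-(-1) ^ (permExt σ 0 + permExt σ 1) * F (pairSeq X a b)) *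
    sign_mul_sign_cast τ

lemma brac_swap_zero_one {N : ℕ} (h : 2 ≤ N) {p : ℕ} (hp : 1 ≤ p) {F : (ℕ → g) → ℂ}
    (hF : OddOn p F) (X : ℕ → g) :
    brac F (fun i => X (permExt (swap (⟨0, by omega⟩ : Fin N) ⟨1, by omega⟩) i)) =
      -brac F X := by
  unfold brac
  rw [← hF 0 hp]
  congr 1
  funext i
  unfold bracSeq
  by_cases hi : i = 0
  · subst hi
    simp [permExt_swap]
  · rw [Function.update_of_ne hi, if_neg hi, if_neg hi]
    beta_reduce
    rw [permExt_swap, if_neg (by simp), if_neg (by simp [hi])]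

lemma asum_brac_eq_sum {N m : ℕ} (hN : N = 2 + m) {F : (ℕ → g) → ℂ}
    (hF : IsSeqForm (1 + m) F) (X : ℕ → g) :
    asum N (brac F) X = -2 * (m.factorial : ℂ) * ∑ i : Fin N, ∑ j : Fin N,
      if (i : ℕ) < (j : ℕ) then (-1 : ℂ) ^ ((i : ℕ) + (j : ℕ)) * F (pairSeq X i j) else 0 := by
  subst hN
  let φ : Fin (2 + m) → Fin (2 + m) → ℂ := fun i j =>
    if (i : ℕ) < (j : ℕ) then (-1 : ℂ) ^ ((i : ℕ) + (j : ℕ)) * F (pairSeq X i j) else 0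
  have hσ : ∀ σ : Perm (Fin (2 + m)),
      ((Perm.sign σ : ℤ) : ℂ) * brac F (fun i => X (permExt σ i)) =
        -(φ (σ ⟨0, by omega⟩) (σ ⟨1, by omega⟩) + φ (σ ⟨1, by omega⟩) (σ ⟨0, by omega⟩)) := by
    intro σ
    have e0 : ((σ ⟨0, by omega⟩ : Fin (2 + m)) : ℕ) = permExt σ 0 := by
      rw [permExt_of_lt σ (by omega)]
    have e1 : ((σ ⟨1, by omega⟩ : Fin (2 + m)) : ℕ) = permExt σ 1 := by
      rw [permExt_of_lt σ (by omega)]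
    simp only [φ, e0, e1]
    rcases lt_trichotomy (permExt σ 0) (permExt σ 1) with h | h | h
    · rw [sign_mul_brac_of_lt hF.antisymm σ h, if_pos h, if_neg (by omega)]
      ring
    · exact absurd (permExt_injective σ h) zero_ne_one
    · let s : Perm (Fin (2 + m)) := swap ⟨0, by omega⟩ ⟨1, by omega⟩
      have hs0 : permExt (σ * s) 0 = permExt σ 1 := by
        rw [permExt_mul, permExt_swap, if_pos rfl]
      have hs1 : permExt (σ * s) 1 = permExt σ 0 := by
        rw [permExt_mul, permExt_swap, if_neg (by simp), if_pos rfl]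
      have key := sign_mul_brac_of_lt hF.antisymm (σ * s) (by rwa [hs0, hs1]) X
      have hsgn : ((Perm.sign s : ℤ) : ℂ) = -1 := by
        rw [Perm.sign_swap (by simp)]; simp
      simp only [hs0, hs1, permExt_mul, sign_mul_cast, hsgn] at key
      rw [brac_swap_zero_one (by omega) (by omega) hF.odd (fun i => X (permExt σ i))] at key
      rw [if_neg (by omega), if_pos h]
      linear_combination key
  unfold asum
  rw [Finset.sum_congr rfl fun σ _ => hσ σ,
    sum_perm_apply_zero_one rfl (fun i j => -(φ i j + φ j i)) fun i => by simp [φ]]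
  simp only [Finset.sum_neg_distrib, Finset.sum_add_distrib]
  rw [Finset.sum_comm (f := fun i j => φ j i)]
  simp only [φ]
  ring

/-- The differential is, up to a factor, an antisymmetrization. -/
lemma asum_brac_eq_sD {p : ℕ} {F : (ℕ → g) → ℂ} (hF : IsSeqForm p F) (X : ℕ → g) :
    (p : ℂ) * asum (p + 1) (brac F) X = -2 * (p.factorial : ℂ) * sD p F X := by
  rcases Nat.eq_zero_or_pos p with rfl | hp
  · simp [sD]
  obtain ⟨m, rfl⟩ := Nat.exists_eq_add_of_le' hp
  rw [asum_brac_eq_sum (m := m) (by omega) (by rwa [add_comm]), Nat.factorial_succ]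
  unfold sD
  push_cast
  ring

lemma sD_eq {p : ℕ} {F : (ℕ → g) → ℂ} (hF : IsSeqForm p F) :
    sD p F = fun X => -(p / (2 * (p.factorial : ℂ))) * asum (p + 1) (brac F) X := by
  funext X
  have h := asum_brac_eq_sD hF X
  have := factorial_cast_ne_zero p
  field_simp
  linear_combination h

lemma sD_zero (F : (ℕ → g) → ℂ) : sD 0 F = fun _ => 0 := by
  funext X
  simp [sD]

lemma sD_const_mul (p : ℕ) (c : ℂ) (F : (ℕ → g) → ℂ) :
    sD p (fun X => c * F X) = fun X => c * sD p F X := by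
  funext X
  simp only [sD, Finset.mul_sum, mul_ite, mul_zero]
  refine Finset.sum_congr rfl fun i _ => Finset.sum_congr rfl fun j _ => ?_
  split_ifs <;> ring

lemma IsSeqForm.sD {p : ℕ} (hp : 1 ≤ p) {F : (ℕ → g) → ℂ} (hF : IsSeqForm p F) :
    IsSeqForm (p + 1) (sD p F) := by
  rw [sD_eq hF]
  exact (isSeqForm_asum (hF.dep.brac hp) (hF.odd.brac hp)).const_mul _

end Differential

section Leibniz

lemma brac_tens {p : ℕ} (hp : 1 ≤ p) (F G : (ℕ → g) → ℂ) :
    brac (tens p F G) = tens (p + 1) (brac F) G := by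
  funext X
  unfold brac tens
  congr 2
  funext i
  unfold bracSeq
  rw [if_neg (by omega), add_right_comm]

lemma brac_tens_cycleRange {p q : ℕ} (hq : 1 ≤ q) {F : (ℕ → g) → ℂ} (hF : DepOn p F)
    (G : (ℕ → g) → ℂ) (X : ℕ → g) :
    brac (fun Y => tens p F G
        (fun i => Y (permExt (⟨p, by omega⟩ : Fin (p + q)).cycleRange i))) X =
      tens p F (brac G) (fun i => X (permExt ((⟨p + 1, by omega⟩ : Fin (p + q + 1)).cycleRange *
        (⟨p + 1, by omega⟩ : Fin (p + q + 1)).cycleRange) i)) := by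
  have hc := permExt_cycleRange_sq (⟨p + 1, by omega⟩ : Fin (p + q + 1))
    (show 1 ≤ p + 1 by omega)
  simp only [brac, tens, hc]
  congr 1
  · refine hF _ _ fun i hi => ?_
    rw [permExt_cycleRange]
    simp only [if_pos hi, if_pos (show i + 1 < p + 1 by omega)]
    rfl
  · congr 1
    funext i
    rw [permExt_cycleRange]
    rcases Nat.eq_zero_or_pos i with rfl | hi
    · simp [bracSeq]
    · simp only [bracSeq]
      split_ifs <;> first | omega | rfl

/-- Each term of the antisymmetrization of `tens p F G` contributes to the bracketed
antisymmetrization according to the factor in which the bracket lands. -/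
lemma asum_brac_tens_comp {p q : ℕ} {F G : (ℕ → g) → ℂ} (hF : IsSeqForm p F)
    (hG : IsSeqForm q G) (σ : Perm (Fin (p + q))) (s : Fin (p + q)) (hs : permExt σ s = 0)
    (X : ℕ → g) :
    ((Perm.sign σ : ℤ) : ℂ) *
        asum (p + q + 1) (brac fun Y => tens p F G (fun i => Y (permExt σ i))) X =
      if (s : ℕ) < p then asum (p + 1 + q) (tens (p + 1) (brac F) G) X
      else (-1) ^ p * asum (p + (q + 1)) (tens p F (brac G)) X := by
  have hpos : 1 ≤ p + q := by have := s.isLt; omega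
  have red : ∀ κ : Perm (Fin (p + q)), permExt κ s = 0 →
      ((Perm.sign σ : ℤ) : ℂ) *
          asum (p + q + 1) (brac fun Y => tens p F G (fun i => Y (permExt σ i))) X =
        ((Perm.sign κ : ℤ) : ℂ) *
          asum (p + q + 1) (brac fun Y => tens p F G (fun i => Y (permExt κ i))) X := by
    intro κ hκ
    have h0 : permExt (σ * κ⁻¹) 0 = 0 := by
      rw [permExt_mul, ← hκ, permExt_inv_apply, hs, hκ]
    have h := congrFun (asum_brac_comp hpos (σ * κ⁻¹) h0
      (fun Y => tens p F G (fun i => Y (permExt κ i)))) X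
    simp only [← permExt_mul, inv_mul_cancel_right] at h
    rw [h, sign_mul_cast, Perm.sign_inv]
    linear_combination (((Perm.sign κ : ℤ) : ℂ) *
      asum (p + q + 1) (brac fun Y => tens p F G (fun i => Y (permExt κ i))) X) *
      sign_mul_sign_cast σ
  split_ifs with hsp
  · let τ : Perm (Fin p) := swap ⟨0, by omega⟩ ⟨s, hsp⟩
    rw [red (permLeft q τ) (by rw [permExt_permLeft, permExt_swap]; simp only; split_ifs <;> omega)]
    have h : (fun Y : ℕ → g => tens p F G (fun i => Y (permExt (permLeft q τ) i))) =
        fun Y => ((Perm.sign τ : ℤ) : ℂ) * tens p F G Y := by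
      funext Y
      simp only [tens, permExt_permLeft]
      rw [hF.antisymm τ Y]
      simp only [permExt_of_le τ (Nat.le_add_right p _)]
      ring
    have h' : (brac fun Y : ℕ → g => tens p F G (fun i => Y (permExt (permLeft q τ) i))) =
        fun Y => ((Perm.sign τ : ℤ) : ℂ) * brac (tens p F G) Y := by
      rw [h]; rfl
    rw [h', asum_const_mul, sign_permLeft, ← mul_assoc, sign_mul_sign_cast, one_mul,
      brac_tens (by omega), add_right_comm]
  · have hq : 1 ≤ q := by omega
    let τ : Perm (Fin q) := swap ⟨0, by omega⟩ ⟨s - p, by omega⟩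
    let c : Perm (Fin (p + q)) := (⟨p, by omega⟩ : Fin (p + q)).cycleRange
    have hκ : permExt (c * permRight p τ) s = 0 := by
      obtain ⟨k, hk⟩ := Nat.exists_eq_add_of_le (show p ≤ s by omega)
      rw [permExt_mul, hk, permExt_permRight_add, permExt_swap, permExt_cycleRange]
      simp only [hk, Nat.add_sub_cancel_left]
      split_ifs <;> omega
    rw [red _ hκ]
    have h : (fun Y : ℕ → g => tens p F G (fun i => Y (permExt (c * permRight p τ) i))) =
        fun Y => ((Perm.sign τ : ℤ) : ℂ) * tens p F G (fun i => Y (permExt c i)) := by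
      funext Y
      simp only [tens, permExt_mul, permExt_permRight_add]
      rw [hG.antisymm τ (fun i => Y (permExt c (p + i))),
        hF.dep (fun i => Y (permExt c (permExt (permRight p τ) i))) (fun i => Y (permExt c i))
          fun i hi => by rw [permExt_permRight_of_lt τ hi]]
      ring
    have h' : (brac fun Y : ℕ → g =>
          tens p F G (fun i => Y (permExt (c * permRight p τ) i))) =
        fun Y => ((Perm.sign τ : ℤ) : ℂ) *
          brac (fun Y => tens p F G (fun i => Y (permExt c i))) Y := by
      rw [h]; rfl
    have h'' := funext (brac_tens_cycleRange hq hF.dep G)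
    rw [h', asum_const_mul, h'']
    beta_reduce
    rw [asum_comp _ (tens p F (brac G)), sign_mul_cast, sign_permRight, sign_mul_cast,
      Fin.sign_cycleRange, Fin.sign_cycleRange, ← add_assoc p q 1]
    push_cast
    have e1 : ((-1 : ℂ) ^ (p + 1)) * (-1) ^ (p + 1) = 1 := by
      rw [← mul_pow]; simp
    linear_combination ((-1) ^ p * asum (p + q + 1) (tens p F (brac G)) X) *
      (sign_mul_sign_cast τ + ((Perm.sign τ : ℤ) : ℂ) * ((Perm.sign τ : ℤ) : ℂ) * e1)

lemma asum_brac_asum_tens {p q : ℕ} {F G : (ℕ → g) → ℂ} (hF : IsSeqForm p F)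
    (hG : IsSeqForm q G) (X : ℕ → g) :
    ((p + q : ℕ) : ℂ) * asum (p + q + 1) (brac (asum (p + q) (tens p F G))) X =
      ((p + q).factorial : ℂ) * (p * asum (p + 1 + q) (tens (p + 1) (brac F) G) X +
        q * ((-1) ^ p * asum (p + (q + 1)) (tens p F (brac G)) X)) := by
  rcases Nat.eq_zero_or_pos (p + q) with h0 | hpos
  · obtain ⟨rfl, rfl⟩ : p = 0 ∧ q = 0 := by omega
    simp
  let f : Fin (p + q) → ℂ := fun s =>
    if (s : ℕ) < p then asum (p + 1 + q) (tens (p + 1) (brac F) G) X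
      else (-1) ^ p * asum (p + (q + 1)) (tens p F (brac G)) X
  have h1 : brac (asum (p + q) (tens p F G)) = fun Y => ∑ σ : Perm (Fin (p + q)),
      ((Perm.sign σ : ℤ) : ℂ) * brac (fun Y => tens p F G (fun i => Y (permExt σ i))) Y := rfl
  have h2 : asum (p + q + 1) (brac (asum (p + q) (tens p F G))) X =
      ∑ σ : Perm (Fin (p + q)), f (σ ⟨0, hpos⟩) := by
    rw [h1, asum_sum, ← Equiv.sum_comp (Equiv.inv (Perm (Fin (p + q)))) (fun σ => f (σ _))]
    refine Finset.sum_congr rfl fun σ _ => ?_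
    rw [asum_const_mul]
    refine asum_brac_tens_comp hF hG σ _ ?_ X
    rw [permExt_coe]
    simp
  rw [h2, card_mul_sum_perm_apply, Fin.sum_univ_add]
  simp [f]

/-- The Leibniz rule. -/
lemma sD_swedge {p q : ℕ} {F G : (ℕ → g) → ℂ} (hF : IsSeqForm p F) (hG : IsSeqForm q G) :
    sD (p + q) (swedge p q F G) = fun X => swedge (p + 1) q (sD p F) G X +
      (-1) ^ p * swedge p (q + 1) F (sD q G) X := by
  funext X
  have key := asum_brac_asum_tens hF hG X
  have hb : brac (swedge p q F G) = fun X => ((p.factorial : ℂ) * (q.factorial : ℂ))⁻¹ *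
      brac (asum (p + q) (tens p F G)) X := rfl
  rw [sD_eq (hF.swedge hG), sD_eq hF, sD_eq hG, hb, asum_const_mul, swedge_const_mul_left,
    swedge_const_mul_right]
  unfold swedge
  rw [asum_tens_asum_left, asum_tens_asum_right _ _ hF.dep]
  have hp := factorial_cast_ne_zero p
  have hq := factorial_cast_ne_zero q
  have hp' := factorial_cast_ne_zero (p + 1)
  have hq' := factorial_cast_ne_zero (q + 1)
  have hpq := factorial_cast_ne_zero (p + q)
  field_simp
  linear_combination -key

end Leibniz

end SequenceDifferential


section Powers

variable {g : Type}

/-- Wedge powers of a `2`-form, for forms seen as functions of sequences. -/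
noncomputable def spow (Ω : (ℕ → g) → ℂ) : ℕ → (ℕ → g) → ℂ
  | 0 => fun _ => 1
  | k + 1 => swedge 2 (2 * k) Ω (spow Ω k)

lemma spow_succ (Ω : (ℕ → g) → ℂ) (k : ℕ) :
    spow Ω (k + 1) = swedge 2 (2 * k) Ω (spow Ω k) := rfl

lemma spow_comp {f : g → g} {Ω : (ℕ → g) → ℂ} (h : ∀ X, Ω (fun i => f (X i)) = Ω X) (k : ℕ)
    (X : ℕ → g) : spow Ω k (fun i => f (X i)) = spow Ω k X := by
  induction k generalizing X with
  | zero => rfl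
  | succ k ih =>
    simp only [spow_succ, swedge, asum, tens]
    simp only [fun Y => h Y, fun Y => ih Y]

variable [LieRing g] {Ω : (ℕ → g) → ℂ}

lemma IsSeqForm.spow (hΩ : IsSeqForm 2 Ω) (k : ℕ) : IsSeqForm (2 * k) (spow Ω k) := by
  induction k with
  | zero =>
    refine ⟨fun _ _ _ => rfl, fun σ X => ?_, fun j hj => absurd hj (by omega)⟩
    rw [show σ = 1 from Subsingleton.elim (α := Equiv.Perm (Fin 0)) σ 1]
    simp [_root_.spow]
  | succ k ih =>
    rw [show 2 * (k + 1) = 2 + 2 * k by omega]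
    exact hΩ.swedge ih

lemma spow_one (hΩ : IsSeqForm 2 Ω) : spow Ω 1 = Ω := swedge_one hΩ.antisymm

lemma spow_add (hΩ : IsSeqForm 2 Ω) (a b : ℕ) :
    swedge (2 * a) (2 * b) (spow Ω a) (spow Ω b) = spow Ω (a + b) := by
  induction a with
  | zero => rw [Nat.zero_add]; exact one_swedge (hΩ.spow b).antisymm
  | succ a ih =>
    rw [spow_succ, show 2 * (a + 1) = 2 + 2 * a by omega, swedge_assoc _ _ _ hΩ.dep, ih,
      show a + 1 + b = a + b + 1 by omega, spow_succ, Nat.mul_add]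

lemma sD_spow_succ (hΩ : IsSeqForm 2 Ω) (k : ℕ) :
    sD (2 * (k + 1)) (spow Ω (k + 1)) =
      fun X => ((k : ℂ) + 1) * swedge 3 (2 * k) (sD 2 Ω) (spow Ω k) X := by
  have hD : IsSeqForm 3 (sD 2 Ω) := hΩ.sD (by omega)
  induction k with
  | zero =>
    rw [spow_one hΩ, show spow Ω 0 = fun _ => 1 from rfl, Nat.mul_zero, swedge_one hD.antisymm]
    simp
  | succ k ih =>
    have hcomm : swedge 2 (2 * (k + 1) + 1) Ω (swedge 3 (2 * k) (sD 2 Ω) (spow Ω k)) =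
        swedge 3 (2 * (k + 1)) (sD 2 Ω) (spow Ω (k + 1)) := by
      rw [show 2 * (k + 1) + 1 = 3 + 2 * k by omega, ← swedge_assoc _ _ _ hΩ.dep,
        swedge_two_comm 3 hΩ.dep hD.dep, add_comm 2 3, swedge_assoc _ _ _ hD.dep,
        show 2 * (k + 1) = 2 + 2 * k by omega, spow_succ]
    rw [spow_succ Ω (k + 1), show 2 * (k + 1 + 1) = 2 + 2 * (k + 1) by omega,
      sD_swedge hΩ (hΩ.spow (k + 1)), ih, swedge_const_mul_right, hcomm]
    funext X
    push_cast
    ring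

end Powers

section ComplexStructure

variable {g : Type} [LieRing g] [LieAlgebra ℝ g] (J : g →ₗ[ℝ] g)

/-- The operator `dᶜ`, for forms seen as functions of sequences. -/
noncomputable def sdc (p : ℕ) (F : (ℕ → g) → ℂ) : (ℕ → g) → ℂ :=
  fun X => (-1) ^ p * ((-1) ^ (p + 1) *
    sD p (fun Y => (-1) ^ p * F (fun i => J (Y i))) (fun i => J (X i)))

lemma IsSeqForm.comp {p : ℕ} {F : (ℕ → g) → ℂ} (hF : IsSeqForm p F) :
    IsSeqForm p (fun X => F (fun i => J (X i))) := by
  refine ⟨fun X Y h => hF.dep _ _ fun i hi => by rw [h i hi],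
    fun σ X => hF.antisymm σ (fun i => J (X i)), fun j hj X => ?_⟩
  rw [← hF.odd j hj]
  congr 1
  funext i
  by_cases h : i = j
  · subst h; simp
  · simp [h]

lemma sdc_two_mul {k : ℕ} {F : (ℕ → g) → ℂ} (hF : ∀ X, F (fun i => J (X i)) = F X) :
    sdc J (2 * k) F = fun X => -sD (2 * k) F (fun i => J (X i)) := by
  funext X
  simp [sdc, hF, pow_succ, pow_mul]

variable {J} {Ω : (ℕ → g) → ℂ}

lemma sdc_two_eq (hJ : ∀ X, Ω (fun i => J (X i)) = Ω X) :
    sdc J 2 Ω = fun X => -1 * sD 2 Ω (fun i => J (X i)) := by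
  funext X
  rw [sdc_two_mul (k := 1) J hJ, neg_one_mul]

lemma IsSeqForm.sdc_two (hΩ : IsSeqForm 2 Ω) (hJ : ∀ X, Ω (fun i => J (X i)) = Ω X) :
    IsSeqForm 3 (sdc J 2 Ω) := by
  rw [sdc_two_eq hJ]
  exact ((hΩ.sD one_le_two).comp J).const_mul _

lemma sdc_spow_succ (hΩ : IsSeqForm 2 Ω) (hJ : ∀ X, Ω (fun i => J (X i)) = Ω X) (k : ℕ) :
    sdc J (2 * (k + 1)) (spow Ω (k + 1)) =
      fun X => ((k : ℂ) + 1) * swedge 3 (2 * k) (sdc J 2 Ω) (spow Ω k) X := by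
  have hc : ∀ X, swedge 3 (2 * k) (sD 2 Ω) (spow Ω k) (fun i => J (X i)) =
      swedge 3 (2 * k) (fun Y => sD 2 Ω (fun i => J (Y i))) (spow Ω k) X := by
    intro X
    simp only [swedge, asum, tens]
    simp only [fun Y => spow_comp (f := J) hJ k Y]
  rw [sdc_two_mul J (spow_comp hJ (k + 1)), sD_spow_succ hΩ, sdc_two_eq hJ, swedge_const_mul_left]
  funext X
  simp only [hc]
  ring

lemma sD_sdc_spow_succ (hΩ : IsSeqForm 2 Ω) (hJ : ∀ X, Ω (fun i => J (X i)) = Ω X) (k : ℕ) :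
    sD (2 * (k + 1) + 1) (sdc J (2 * (k + 1)) (spow Ω (k + 1))) =
      fun X => ((k : ℂ) + 1) * (swedge 4 (2 * k) (sD 3 (sdc J 2 Ω)) (spow Ω k) X +
        -1 * swedge 3 (2 * k + 1) (sdc J 2 Ω) (sD (2 * k) (spow Ω k)) X) := by
  rw [sdc_spow_succ hΩ hJ, sD_const_mul, show 2 * (k + 1) + 1 = 3 + 2 * k by omega,
    sD_swedge (hΩ.sdc_two hJ) (hΩ.spow k)]
  norm_num

/-- The formula for `ddᶜ(ω^k) ∧ ω^m`, for forms seen as functions of sequences. -/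
lemma sD_sdc_spow_swedge (hΩ : IsSeqForm 2 Ω) (hJ : ∀ X, Ω (fun i => J (X i)) = Ω X)
    (k m : ℕ) (X : ℕ → g) :
    swedge (2 * (k + 1) + 1 + 1) (2 * m)
        (sD (2 * (k + 1) + 1) (sdc J (2 * (k + 1)) (spow Ω (k + 1)))) (spow Ω m) X =
      ((k : ℂ) + 1) * swedge 4 (2 * (k + m)) (sD 3 (sdc J 2 Ω)) (spow Ω (k + m)) X -
      ((k : ℂ) + 1) * k * swedge 3 (3 + 2 * (k + m - 1)) (sdc J 2 Ω)
        (swedge 3 (2 * (k + m - 1)) (sD 2 Ω) (spow Ω (k + m - 1))) X := by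
  have hη := hΩ.sdc_two hJ
  have hdη : IsSeqForm 4 (sD 3 (sdc J 2 Ω)) := hη.sD (by omega)
  have hD : IsSeqForm 3 (sD 2 Ω) := hΩ.sD (by omega)
  rw [sD_sdc_spow_succ hΩ hJ, swedge_const_mul_left, swedge_add_left, swedge_const_mul_left,
    show 2 * (k + 1) + 1 + 1 = 4 + 2 * k by omega, swedge_assoc _ _ _ hdη.dep, spow_add hΩ,
    ← Nat.mul_add, show 4 + 2 * k = 3 + (2 * k + 1) by omega, swedge_assoc _ _ _ hη.dep]
  rcases k with _ | k
  · rw [show 2 * 0 = 0 from rfl, sD_zero]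
    have h0 : swedge (0 + 1) (2 * m) (fun _ => 0) (spow Ω m) = fun _ => 0 := by
      funext Y; simp [swedge, asum, tens]
    have h0' : swedge 3 (0 + 1 + 2 * m) (sdc J 2 Ω) (fun _ => 0) = fun _ => 0 := by
      funext Y; simp [swedge, asum, tens]
    rw [h0, h0']
    simp
  · rw [sD_spow_succ hΩ, swedge_const_mul_left, swedge_const_mul_right,
      show 2 * (k + 1) + 1 = 3 + 2 * k by omega, swedge_assoc _ _ _ hD.dep, spow_add hΩ,
      add_assoc 3, ← Nat.mul_add, show k + 1 + m - 1 = k + m by omega]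
    push_cast
    ring

end ComplexStructure

section Bridge

open Equiv

variable {g : Type}

/-- A form, seen as a function of sequences. -/
def seqForm {p : ℕ} (η : (Fin p → g) → ℂ) : (ℕ → g) → ℂ := fun X => η (fun i => X i)

lemma exists_seq_extension [Zero g] {N : ℕ} (X : Fin N → g) :
    ∃ Y : ℕ → g, (fun i : Fin N => Y i) = X :=
  ⟨fun i => if h : i < N then X ⟨i, h⟩ else 0, by funext i; simp⟩

variable [LieRing g]

lemma isSeqForm_seqForm [LieAlgebra ℝ g] {p : ℕ} (ω : AlternatingMap ℝ g ℂ (Fin p)) :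
    IsSeqForm p (seqForm fun v => ω v) := by
  refine ⟨fun X Y h => ?_, fun σ X => ?_, fun j hj X => ?_⟩
  · exact congrArg ω (funext fun i => h i i.isLt)
  · have h := ω.map_perm (fun i : Fin p => X i) σ
    simp only [seqForm, permExt_coe]
    rw [show (fun i : Fin p => X (σ i)) = (fun i : Fin p => X i) ∘ σ from rfl, h]
    rcases Int.units_eq_one_or (Perm.sign σ) with hs | hs <;> rw [hs] <;> simp
  · have h : (fun i : Fin p => Function.update X j (-X j) i) =
        Function.update (fun i : Fin p => X i) ⟨j, hj⟩ (-X j) := by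
      funext i
      by_cases hi : (i : ℕ) = j
      · subst hi; simp
      · rw [Function.update_of_ne hi, Function.update_of_ne (fun h => hi (by rw [h]))]
    simp only [seqForm, h]
    rw [AlternatingMap.map_update_neg]
    congr 2
    exact Function.update_eq_self (⟨j, hj⟩ : Fin p) fun i : Fin p => X i

variable [LieAlgebra ℝ g]

lemma seqForm_wedge {p q : ℕ} (α : (Fin p → g) → ℂ) (β : (Fin q → g) → ℂ) :
    seqForm (wedge α β) = swedge p q (seqForm α) (seqForm β) := by
  funext X
  simp only [seqForm, wedge, swedge, asum, tens]
  congr 1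
  refine Finset.sum_congr rfl fun σ _ => ?_
  rw [mul_assoc]
  congr 3 <;> funext i <;> rw [← permExt_coe] <;> rfl

lemma seqForm_ceD {p : ℕ} (η : (Fin p → g) → ℂ) : seqForm (ceD η) = sD p (seqForm η) := by
  funext X
  simp only [seqForm, ceD, sD]
  refine Finset.sum_congr rfl fun i _ => Finset.sum_congr rfl fun j _ => ?_
  simp only [dite_eq_ite]
  rfl

lemma seqForm_dcD (J : g →ₗ[ℝ] g) {p : ℕ} (η : (Fin p → g) → ℂ) :
    seqForm (dcD J η) = sdc J p (seqForm η) := by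
  have h : seqForm (ceD (Jact J η)) = sD p (fun Y => (-1) ^ p * seqForm η (fun i => J (Y i))) :=
    seqForm_ceD _
  funext X
  simp only [sdc, ← h]
  rfl

lemma seqForm_wpow_eq (ω : (Fin 2 → g) → ℂ) (k : ℕ) :
    seqForm (wpow ω k) = fun X => ((2 : ℂ) ^ k)⁻¹ * asum (2 * k)
      (fun Y => ∏ t : Fin k, seqForm ω (fun s => Y (2 * t + s))) X := by
  funext X
  simp only [seqForm, wpow, asum]
  congr 1
  refine Finset.sum_congr rfl fun σ _ => ?_
  congr 1
  refine Finset.prod_congr rfl fun t _ => ?_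
  congr 1
  funext s
  rw [← permExt_coe]

lemma seqForm_wpow {ω : (Fin 2 → g) → ℂ} (hω : DepOn 2 (seqForm ω)) (k : ℕ) :
    seqForm (wpow ω k) = spow (seqForm ω) k := by
  induction k with
  | zero =>
    rw [seqForm_wpow_eq]
    funext X
    simp [asum, spow]
  | succ k ih =>
    rw [spow_succ, ← ih, seqForm_wpow_eq, seqForm_wpow_eq, swedge_const_mul_right]
    funext X
    have h : (fun Y : ℕ → g => ∏ t : Fin (k + 1), seqForm ω (fun s => Y (2 * t + s))) =
        tens 2 (seqForm ω) (fun Y => ∏ t : Fin k, seqForm ω (fun s => Y (2 * t + s))) := by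
      funext Y
      rw [Fin.prod_univ_succ]
      simp only [tens, Fin.val_zero, Fin.val_succ, Nat.mul_zero, Nat.zero_add]
      congr 1
      refine Finset.prod_congr rfl fun t _ => ?_
      congr 1
      funext s
      congr 1
      omega
    have := factorial_cast_ne_zero (2 * k)
    rw [h, swedge, asum_tens_asum_right _ _ hω, show 2 * (k + 1) = 2 + 2 * k by omega, pow_succ]
    simp only [Nat.factorial_two]
    push_cast
    field_simp

end Bridge

/-- Let `𝔤` be a real Lie algebra of dimension `2n`, `n ≥ 3`, with complex
structure `J`, and let `ω` be a real `2`-form of type `(1,1)` on `𝔤`.  Then for every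
`1 ≤ k ≤ n−1` one has, as `2n`-forms,
`ddᶜ(ω^k) ∧ ω^{n−k−1} = k (ddᶜω) ∧ ω^{n−2} − k(k−1) (dᶜω) ∧ dω ∧ ω^{n−3}`. -/
theorem statement3 (n k : ℕ) (hn : 3 ≤ n) (hk1 : 1 ≤ k) (hk2 : k ≤ n - 1)
    (g : Type) [LieRing g] [LieAlgebra ℝ g] [FiniteDimensional ℝ g]
    (hdim : Module.finrank ℝ g = 2 * n)
    (J : g →ₗ[ℝ] g)
    (hJ2 : ∀ x, J (J x) = -x)
    (hJi : ∀ x y : g, J ⁅x, y⁆ - ⁅J x, y⁆ - ⁅x, J y⁆ - J ⁅J x, J y⁆ = 0)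
    (ω : AlternatingMap ℝ g ℂ (Fin 2))
    (hreal : ∀ v, (ω v).im = 0)
    (h11 : ∀ v : Fin 2 → g, ω (fun i => J (v i)) = ω v) :
    reind (by omega) (wedge (ceD (dcD J (wpow (fun v => ω v) k)))
        (wpow (fun v => ω v) (n - k - 1))) =
      (fun X : Fin (2 * n) → g =>
        (k : ℂ) * reind (by omega)
            (wedge (ceD (dcD J (fun v => ω v))) (wpow (fun v => ω v) (n - 2))) X
        - (k : ℂ) * ((k : ℂ) - 1) * reind (by omega)
            (wedge (dcD J (fun v => ω v))
              (wedge (ceD (fun v => ω v)) (wpow (fun v => ω v) (n - 3)))) X) := by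
  obtain ⟨j, rfl⟩ := Nat.exists_eq_add_of_le' hk1
  obtain ⟨m, rfl⟩ := Nat.exists_eq_add_of_le (show j + 2 ≤ n by omega)
  have hΩ := isSeqForm_seqForm ω
  have hJ : ∀ X, seqForm (fun v => ω v) (fun i => J (X i)) = seqForm (fun v => ω v) X :=
    fun X => h11 _
  funext Z
  obtain ⟨X, rfl⟩ := exists_seq_extension Z
  change seqForm (wedge (ceD (dcD J (wpow (fun v => ω v) (j + 1)))) (wpow (fun v => ω v) _)) X =
    _ * seqForm (wedge (ceD (dcD J (fun v => ω v))) (wpow (fun v => ω v) _)) X -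
      _ * seqForm (wedge (dcD J (fun v => ω v))
        (wedge (ceD (fun v => ω v)) (wpow (fun v => ω v) _))) X
  simp only [seqForm_wedge, seqForm_ceD, seqForm_dcD, seqForm_wpow hΩ.dep]
  rw [show j + 2 + m - (j + 1) - 1 = m by omega, show j + 2 + m - 2 = j + m by omega,
    show j + 2 + m - 3 = j + m - 1 by omega]
  have key := sD_sdc_spow_swedge hΩ hJ j m X
  push_cast
  rw [add_sub_cancel_right]
  exact key
end

section
/- Let 𝔤 be a real Lie algebra of dimension 2n, n ≥ 3, with complex structure J, and let ω be a positive (1,1)-form on 𝔤. Call ω k-Gauduchon (1 ≤ k ≤ n−1) if ddᶜ(ω^k) ∧ ω^{n−k−1} = 0. If ω is k₁-Gauduchon and k₂-Gauduchon for some 1 ≤ k₁ < k₂ ≤ n−1, then ω is k-Gauduchon for every 1 ≤ k ≤ n−1; in particular ddᶜ(ω^{n−1}) = 0, i.e. ω is Gauduchon, and moreover ddᶜω ∧ ω^{n−2} = 0 and dᶜω ∧ dω ∧ ω^{n−3} = 0. -/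
open scoped BigOperators

/-- Inhomogeneous raw forms: complex functions of a list of vectors of arbitrary length. -/
@[ext] structure ListForm (g : Type) where
  /-- The underlying function on lists of vectors. -/
  toFun : List g → ℂ

namespace ListForm

section Shuffle

variable {g : Type}

instance : CoeFun (ListForm g) fun _ => List g → ℂ := ⟨toFun⟩

theorem toFun_injective : Function.Injective (toFun : ListForm g → List g → ℂ) :=
  fun _ _ h => ListForm.ext h

theorem ext_apply {f h : ListForm g} (H : ∀ L, f L = h L) : f = h := ListForm.ext (funext H)

noncomputable instance : Zero (ListForm g) := ⟨⟨0⟩⟩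
noncomputable instance : Add (ListForm g) := ⟨fun f h => ⟨fun L => f L + h L⟩⟩
noncomputable instance : Neg (ListForm g) := ⟨fun f => ⟨fun L => -f L⟩⟩
noncomputable instance : Sub (ListForm g) := ⟨fun f h => ⟨fun L => f L - h L⟩⟩
noncomputable instance : SMul ℕ (ListForm g) := ⟨fun c f => ⟨fun L => c • f L⟩⟩
noncomputable instance : SMul ℤ (ListForm g) := ⟨fun c f => ⟨fun L => c • f L⟩⟩
noncomputable instance : SMul ℂ (ListForm g) := ⟨fun c f => ⟨fun L => c * f L⟩⟩

noncomputable instance : AddCommGroup (ListForm g) :=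
  toFun_injective.addCommGroup _ rfl (fun _ _ => rfl) (fun _ => rfl) (fun _ _ => rfl)
    (fun _ _ => rfl) (fun _ _ => rfl)

/-- Evaluation as an additive map. -/
def evalHom : ListForm g →+ (List g → ℂ) where
  toFun := toFun
  map_zero' := rfl
  map_add' _ _ := rfl

noncomputable instance : Module ℂ (ListForm g) :=
  toFun_injective.module ℂ evalHom (fun _ _ => rfl)

@[simp] theorem add_apply (f h : ListForm g) (L : List g) : (f + h) L = f L + h L := rfl
@[simp] theorem sub_apply (f h : ListForm g) (L : List g) : (f - h) L = f L - h L := rfl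
@[simp] theorem neg_apply (f : ListForm g) (L : List g) : (-f) L = -f L := rfl
@[simp] theorem zero_apply (L : List g) : (0 : ListForm g) L = 0 := rfl
@[simp] theorem smul_apply (c : ℂ) (f : ListForm g) (L : List g) : (c • f) L = c * f L := rfl

/-- Interior product: insertion of `x` in the first slot. -/
def contract (x : g) : ListForm g →ₗ[ℂ] ListForm g where
  toFun f := ⟨fun L => f (x :: L)⟩
  map_add' _ _ := rfl
  map_smul' _ _ := rfl

@[simp] theorem contract_apply (x : g) (f : ListForm g) (L : List g) :
    contract x f L = f (x :: L) := rfl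

/-- The parity involution, `(-1)^p` on forms of degree `p`. -/
noncomputable def parity : ListForm g →ₗ[ℂ] ListForm g where
  toFun f := ⟨fun L => (-1) ^ L.length * f L⟩
  map_add' f h := by refine ext_apply fun L => ?_; simp [mul_add]
  map_smul' c f := by refine ext_apply fun L => ?_; simp; ring

@[simp] theorem parity_apply (f : ListForm g) (L : List g) :
    parity f L = (-1) ^ L.length * f L := rfl

theorem contract_parity (x : g) (f : ListForm g) :
    contract x (parity f) = -parity (contract x f) := by
  refine ext_apply fun L => ?_; simp [pow_succ]

@[simp] theorem parity_parity (f : ListForm g) : parity (parity f) = f := by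
  refine ext_apply fun L => ?_; simp [← mul_assoc, ← mul_pow]

/-- The signed shuffle product, characterised by
`ι_x (f * h) = ι_x f * h + parity f * ι_x h`. -/
noncomputable def shuffle : List g → ListForm g → ListForm g → ℂ
  | [], f, h => f [] * h []
  | x :: L, f, h => shuffle L (contract x f) h + shuffle L (parity f) (contract x h)

noncomputable instance : Mul (ListForm g) := ⟨fun f h => ⟨fun L => shuffle L f h⟩⟩

theorem mul_nil (f h : ListForm g) : (f * h) [] = f [] * h [] := rfl

theorem mul_cons (f h : ListForm g) (x : g) (L : List g) :
    (f * h) (x :: L) = (contract x f * h) L + (parity f * contract x h) L := rfl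

noncomputable instance : One (ListForm g) := ⟨⟨fun L => match L with | [] => 1 | _ :: _ => 0⟩⟩

theorem one_nil : (1 : ListForm g) [] = 1 := rfl
theorem one_cons (x : g) (L : List g) : (1 : ListForm g) (x :: L) = 0 := rfl
theorem contract_one (x : g) : contract x (1 : ListForm g) = 0 := rfl
theorem parity_one : parity (1 : ListForm g) = 1 := by
  refine ext_apply fun L => ?_; cases L <;> simp [one_nil, one_cons]

protected theorem add_mul' (L : List g) : ∀ a b c : ListForm g,
    ((a + b) * c) L = (a * c) L + (b * c) L := by
  induction L with
  | nil => intro a b c; simp [mul_nil, add_mul]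
  | cons x L ih => intro a b c; simp only [mul_cons, map_add, ih]; ring

protected theorem mul_add' (L : List g) : ∀ a b c : ListForm g,
    (a * (b + c)) L = (a * b) L + (a * c) L := by
  induction L with
  | nil => intro a b c; simp [mul_nil, mul_add]
  | cons x L ih => intro a b c; simp only [mul_cons, map_add, ih]; ring

protected theorem smul_mul' (L : List g) : ∀ (r : ℂ) (a b : ListForm g),
    ((r • a) * b) L = r * (a * b) L := by
  induction L with
  | nil => intro r a b; simp [mul_nil, mul_assoc]
  | cons x L ih => intro r a b; simp only [mul_cons, map_smul, ih]; ring

protected theorem mul_smul' (L : List g) : ∀ (r : ℂ) (a b : ListForm g),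
    (a * (r • b)) L = r * (a * b) L := by
  induction L with
  | nil => intro r a b; simp [mul_nil]; ring
  | cons x L ih => intro r a b; simp only [mul_cons, map_smul, ih]; ring

protected theorem zero_mul' (a : ListForm g) : 0 * a = 0 := by
  refine ext_apply fun L => ?_; simpa using ListForm.smul_mul' L 0 0 a

protected theorem mul_zero' (a : ListForm g) : a * 0 = 0 := by
  refine ext_apply fun L => ?_; simpa using ListForm.mul_smul' L 0 a 0

theorem parity_mul_apply (L : List g) : ∀ a b : ListForm g,
    parity (a * b) L = (parity a * parity b) L := by
  induction L with
  | nil => intro a b; simp [mul_nil]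
  | cons x L ih =>
    intro a b
    have h1 := ih (contract x a) b
    have h2 := ih (parity a) (contract x b)
    have e1 : -parity (contract x a) = (-1 : ℂ) • parity (contract x a) := by simp
    have e2 : -parity (contract x b) = (-1 : ℂ) • parity (contract x b) := by simp
    simp only [parity_apply, List.length_cons, mul_cons, contract_parity, e1, e2,
      ListForm.smul_mul', ListForm.mul_smul', parity_parity] at h1 h2 ⊢
    rw [← h1, ← h2]; ring

theorem parity_mul (a b : ListForm g) : parity (a * b) = parity a * parity b :=
  ext_apply fun L => parity_mul_apply L a b

theorem contract_mul (x : g) (a b : ListForm g) :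
    contract x (a * b) = contract x a * b + parity a * contract x b := rfl

protected theorem mul_assoc' (L : List g) : ∀ a b c : ListForm g,
    (a * b * c) L = (a * (b * c)) L := by
  induction L with
  | nil => intro a b c; simp [mul_nil, mul_assoc]
  | cons x L ih =>
    intro a b c
    simp only [mul_cons, contract_mul, parity_mul, ListForm.add_mul', ListForm.mul_add', ih]
    ring

noncomputable instance : Ring (ListForm g) :=
  { (inferInstance : AddCommGroup (ListForm g)) with
    left_distrib := fun a b c => ext_apply fun L => ListForm.mul_add' L a b c
    right_distrib := fun a b c => ext_apply fun L => ListForm.add_mul' L a b c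
    zero_mul := ListForm.zero_mul'
    mul_zero := ListForm.mul_zero'
    mul_assoc := fun a b c => ext_apply fun L => ListForm.mul_assoc' L a b c
    one_mul := fun a => by
      refine ext_apply fun L => ?_
      induction L generalizing a with
      | nil => simp [mul_nil, one_nil]
      | cons x L ih =>
        rw [mul_cons, contract_one, parity_one, ih, ListForm.zero_mul']; simp
    mul_one := fun a => by
      refine ext_apply fun L => ?_
      induction L generalizing a with
      | nil => simp [mul_nil, one_nil]
      | cons x L ih =>
        rw [mul_cons, contract_one, ih, ListForm.mul_zero']; simp }

noncomputable instance : Algebra ℂ (ListForm g) :=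
  Algebra.ofModule (fun r a b => ext_apply fun L => ListForm.smul_mul' L r a b)
    (fun r a b => ext_apply fun L => ListForm.mul_smul' L r a b)

theorem graded_comm_apply (L : List g) : ∀ a b : ListForm g,
    (parity a = a → (a * b) L = (b * a) L) ∧
    (parity a = -a → (a * b) L = (parity b * a) L) := by
  induction L with
  | nil =>
    intro a b
    refine ⟨fun _ => ?_, fun _ => ?_⟩ <;> simp [mul_nil, mul_comm]
  | cons x L ih =>
    intro a b
    constructor
    · intro ha
      have hx : parity (contract x a) = -contract x a := by
        rw [← neg_eq_iff_eq_neg, ← contract_parity, ha]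
      rw [mul_cons, mul_cons, ha, (ih _ _).1 ha, (ih _ _).2 hx]; ring
    · intro ha
      have hx : parity (contract x a) = contract x a := by
        rw [← neg_inj, ← contract_parity, ha, map_neg]
      rw [mul_cons, mul_cons, ha, (ih _ _).1 hx, neg_mul, neg_apply, (ih _ _).2 ha,
        contract_parity, parity_parity, neg_mul, neg_apply]
      ring

theorem commute_of_parity_eq {a : ListForm g} (ha : parity a = a) (b : ListForm g) :
    a * b = b * a := ext_apply fun L => (graded_comm_apply L a b).1 ha

/-- The concatenation (tensor) product of raw forms. -/
noncomputable def concat : List g → ListForm g → ListForm g → ℂ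
  | [], f, h => f [] * h []
  | x :: L, f, h => f [] * h (x :: L) + concat L (contract x f) h

/-- The concatenation product, as a form. -/
noncomputable def tensor (f h : ListForm g) : ListForm g := ⟨fun L => concat L f h⟩

theorem tensor_nil (f h : ListForm g) : tensor f h [] = f [] * h [] := rfl

theorem contract_tensor (x : g) (f h : ListForm g) :
    contract x (tensor f h) = f [] • contract x h + tensor (contract x f) h := rfl

theorem tensor_cons (f h : ListForm g) (x : g) (L : List g) :
    tensor f h (x :: L) = f [] * h (x :: L) + tensor (contract x f) h L := rfl

theorem tensor_add_left (L : List g) : ∀ a b c : ListForm g,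
    tensor (a + b) c L = tensor a c L + tensor b c L := by
  induction L with
  | nil => intro a b c; simp [tensor_nil, add_mul]
  | cons x L ih => intro a b c; simp only [tensor_cons, map_add, ih, add_apply]; ring

theorem tensor_smul_left (L : List g) : ∀ (r : ℂ) (a b : ListForm g),
    tensor (r • a) b L = r * tensor a b L := by
  induction L with
  | nil => intro r a b; simp [tensor_nil, mul_assoc]
  | cons x L ih => intro r a b; simp only [tensor_cons, map_smul, ih, smul_apply]; ring

theorem tensor_neg_left (L : List g) (a b : ListForm g) :
    tensor (-a) b L = -tensor a b L := by
  simpa using tensor_smul_left L (-1) a b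

theorem tensor_zero_left (a : ListForm g) : tensor 0 a = 0 := by
  refine ext_apply fun L => ?_; simpa using tensor_smul_left L 0 0 a

/-- A form is homogeneous of degree `p` if it vanishes on lists of any other length. -/
def Homog (p : ℕ) (f : ListForm g) : Prop := ∀ L : List g, L.length ≠ p → f L = 0

theorem Homog.contract {p : ℕ} {f : ListForm g} (hf : Homog (p + 1) f) (x : g) :
    Homog p (contract x f) := fun L hL => hf _ (by simpa using hL)

theorem Homog.contract_zero {f : ListForm g} (hf : Homog 0 f) (x : g) :
    ListForm.contract x f = 0 := ext_apply fun L => hf _ (by simp)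

theorem Homog.parity {p : ℕ} {f : ListForm g} (hf : Homog p f) :
    parity f = (-1 : ℂ) ^ p • f := by
  refine ext_apply fun L => ?_
  by_cases h : L.length = p
  · simp [h]
  · simp [hf L h]

theorem Homog.mul {p q : ℕ} {f h : ListForm g} (hf : Homog p f) (hh : Homog q h) :
    Homog (p + q) (f * h) := by
  have zero_mul_apply : ∀ (a : ListForm g) (L : List g), (0 * a) L = 0 := fun a L => by
    rw [zero_mul, zero_apply]
  have mul_zero_apply : ∀ (a : ListForm g) (L : List g), (a * 0) L = 0 := fun a L => by
    rw [mul_zero, zero_apply]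
  intro L hL
  induction L generalizing p q f h with
  | nil =>
    rw [mul_nil]
    by_cases hp : p = 0
    · rw [hh [] (by simp at hL ⊢; omega), mul_zero]
    · rw [hf [] (by simp; omega), zero_mul]
  | cons x L ih =>
    simp only [List.length_cons] at hL
    rw [mul_cons, hf.parity, smul_mul_assoc, smul_apply]
    have h1 : (ListForm.contract x f * h) L = 0 := by
      rcases p with _ | p
      · rw [hf.contract_zero, zero_mul_apply]
      · exact ih (hf.contract x) hh (by omega)
    have h2 : (f * ListForm.contract x h) L = 0 := by
      rcases q with _ | q
      · rw [hh.contract_zero, mul_zero_apply]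
      · exact ih hf (hh.contract x) (by omega)
    rw [h1, h2, mul_zero, add_zero]

theorem tensor_append {p : ℕ} {f : ListForm g} (hf : Homog p f) (h : ListForm g)
    (L M : List g) (hL : L.length = p) : tensor f h (L ++ M) = f L * h M := by
  induction L generalizing p f with
  | nil =>
    subst hL
    cases M with
    | nil => rfl
    | cons x M => simp [tensor_cons, hf.contract_zero, tensor_zero_left]
  | cons x L ih =>
    subst hL
    have h0 : f [] = 0 := hf [] (by simp)
    rw [List.cons_append, tensor_cons, h0, ih (hf.contract x) rfl]
    simp

/-- Signed sum over all ways of inserting `x` in a slot. -/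
noncomputable def insertSum (x : g) : List g → ListForm g → ℂ
  | [], f => f [x]
  | y :: L, f => f (x :: y :: L) - insertSum x L (contract y f)

/-- The signed insertion operator, an antiderivation of the concatenation product. -/
noncomputable def insertOp (x : g) (f : ListForm g) : ListForm g := ⟨fun L => insertSum x L f⟩

theorem insertOp_nil (x : g) (f : ListForm g) : insertOp x f [] = f [x] := rfl

theorem insertOp_cons (x y : g) (f : ListForm g) (L : List g) :
    insertOp x f (y :: L) = f (x :: y :: L) - insertOp x (contract y f) L := rfl

theorem contract_insertOp (x y : g) (f : ListForm g) :
    contract y (insertOp x f) = contract y (contract x f) - insertOp x (contract y f) := rfl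

theorem insertOp_add (x : g) (L : List g) : ∀ a b : ListForm g,
    insertOp x (a + b) L = insertOp x a L + insertOp x b L := by
  induction L with
  | nil => intro a b; rfl
  | cons y L ih => intro a b; simp only [insertOp_cons, map_add, ih, add_apply]; ring

theorem insertOp_smul (x : g) (L : List g) : ∀ (r : ℂ) (a : ListForm g),
    insertOp x (r • a) L = r * insertOp x a L := by
  induction L with
  | nil => intro r a; rfl
  | cons y L ih => intro r a; simp only [insertOp_cons, map_smul, ih, smul_apply]; ring

theorem insertOp_tensor (x : g) (L : List g) : ∀ f h : ListForm g,
    insertOp x (tensor f h) L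
      = tensor (insertOp x f) h L + tensor (parity f) (insertOp x h) L := by
  induction L with
  | nil =>
    intro f h
    simp [insertOp_nil, tensor_nil, tensor_cons]
    ring
  | cons y L ih =>
    intro f h
    have e1 : contract y (insertOp x f)
      = contract y (contract x f) + (-1 : ℂ) • insertOp x (contract y f) := by
      rw [contract_insertOp, neg_one_smul, sub_eq_add_neg]
    simp only [insertOp_cons, contract_tensor, insertOp_add, insertOp_smul, ih, tensor_cons,
      contract_parity, tensor_neg_left, e1, tensor_add_left, tensor_smul_left, insertOp_nil,
      parity_apply, contract_apply, List.length_nil]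
    ring

/-- Recursive form of the (unnormalised) antisymmetrisation. -/
noncomputable def altSum : List g → ListForm g → ℂ
  | [], f => f []
  | x :: L, f => altSum L (insertOp x f)

/-- The (unnormalised) antisymmetrisation of a raw form. -/
noncomputable def antisymm (f : ListForm g) : ListForm g := ⟨fun L => altSum L f⟩

theorem antisymm_nil (f : ListForm g) : antisymm f [] = f [] := rfl

theorem antisymm_cons (f : ListForm g) (x : g) (L : List g) :
    antisymm f (x :: L) = antisymm (insertOp x f) L := rfl

theorem antisymm_add (L : List g) : ∀ a b : ListForm g,
    antisymm (a + b) L = antisymm a L + antisymm b L := by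
  induction L with
  | nil => intro a b; rfl
  | cons x L ih =>
    intro a b
    rw [antisymm_cons, show insertOp x (a + b) = insertOp x a + insertOp x b from
      ext_apply fun L => insertOp_add x L a b, ih]
    rfl

theorem antisymm_smul (L : List g) : ∀ (r : ℂ) (a : ListForm g),
    antisymm (r • a) L = r * antisymm a L := by
  induction L with
  | nil => intro r a; rfl
  | cons x L ih =>
    intro r a
    rw [antisymm_cons, show insertOp x (r • a) = r • insertOp x a from
      ext_apply fun L => insertOp_smul x L r a, ih]
    rfl

theorem insertOp_parity (x : g) (L : List g) : ∀ f : ListForm g,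
    insertOp x (parity f) L = -parity (insertOp x f) L := by
  induction L with
  | nil => intro f; simp [insertOp_nil]
  | cons y L ih =>
    intro f
    have e : contract y (parity f) = (-1 : ℂ) • parity (contract y f) := by
      rw [contract_parity]; simp
    rw [insertOp_cons, e, insertOp_smul, ih]
    simp [insertOp_cons, pow_succ]
    ring

theorem antisymm_parity (L : List g) : ∀ f : ListForm g,
    antisymm (parity f) L = parity (antisymm f) L := by
  induction L with
  | nil => intro f; simp [antisymm_nil]
  | cons x L ih =>
    intro f
    have e : insertOp x (parity f) = (-1 : ℂ) • parity (insertOp x f) := by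
      refine ext_apply fun L => ?_; simp [insertOp_parity]
    rw [antisymm_cons, e, antisymm_smul, ih]
    simp [antisymm_cons, pow_succ]

theorem antisymm_tensor_apply (L : List g) : ∀ f h : ListForm g,
    antisymm (tensor f h) L = (antisymm f * antisymm h) L := by
  induction L with
  | nil => intro f h; rfl
  | cons x L ih =>
    intro f h
    rw [antisymm_cons, show insertOp x (tensor f h)
      = tensor (insertOp x f) h + tensor (parity f) (insertOp x h) from
      ext_apply fun L => insertOp_tensor x L f h, antisymm_add, ih, ih, mul_cons,
      show antisymm (parity f) = parity (antisymm f) from ext_apply fun L => antisymm_parity L f]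
    rfl

theorem antisymm_tensor (f h : ListForm g) :
    antisymm (tensor f h) = antisymm f * antisymm h :=
  ext_apply fun L => antisymm_tensor_apply L f h

/-- Antisymmetry under exchange of adjacent arguments. -/
def SwapNeg (f : ListForm g) : Prop :=
  ∀ (L : List g) (x y : g) (M : List g), f (L ++ x :: y :: M) = -f (L ++ y :: x :: M)

theorem SwapNeg.contract {f : ListForm g} (hf : SwapNeg f) (x : g) :
    SwapNeg (contract x f) := fun L => hf (x :: L)

theorem SwapNeg.smul {f : ListForm g} (hf : SwapNeg f) (c : ℂ) : SwapNeg (c • f) := by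
  intro L x y M; simp [hf L x y M]

theorem SwapNeg.parity {f : ListForm g} (hf : SwapNeg f) : SwapNeg (parity f) := by
  intro L x y M; simp [hf L x y M]

theorem SwapNeg.contract_contract {f : ListForm g} (hf : SwapNeg f) (x y : g) :
    ListForm.contract y (ListForm.contract x f)
      = -ListForm.contract x (ListForm.contract y f) :=
  ext_apply fun L => hf [] x y L

theorem SwapNeg.mul {f h : ListForm g} (hf : SwapNeg f) (hh : SwapNeg h) : SwapNeg (f * h) := by
  intro L x y M
  induction L generalizing f h with
  | nil =>
    simp only [List.nil_append, mul_cons, contract_parity, neg_mul, neg_apply,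
      hf.contract_contract x y, hh.contract_contract x y, mul_neg, parity_parity]
    ring
  | cons z L ih =>
    simp only [List.cons_append, mul_cons]
    rw [ih (hf.contract z) hh, ih hf.parity (hh.contract z)]
    ring

theorem SwapNeg.one : SwapNeg (1 : ListForm g) := by
  intro L x y M
  cases L <;> simp [one_cons]

theorem SwapNeg.pow {f : ListForm g} (hf : SwapNeg f) (k : ℕ) : SwapNeg (f ^ k) := by
  induction k with
  | zero => simpa using SwapNeg.one
  | succ k ih => rw [pow_succ]; exact ih.mul hf

theorem SwapNeg.insertOp_apply {f : ListForm g} (hf : SwapNeg f) (x : g) (L : List g) :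
    insertOp x f L = (L.length + 1) * f (x :: L) := by
  induction L generalizing f with
  | nil => simp [insertOp_nil]
  | cons y L ih =>
    have := hf [] x y L
    simp only [List.nil_append] at this
    rw [insertOp_cons, ih (hf.contract y), contract_apply, this]
    push_cast [List.length_cons]
    ring

theorem antisymm_of_swapNeg {p : ℕ} {f : ListForm g} (hf : SwapNeg f) (hp : Homog p f)
    (L : List g) : antisymm f L = p.factorial * f L := by
  induction L generalizing p f with
  | nil =>
    rw [antisymm_nil]
    rcases p with _ | p
    · simp
    · rw [hp [] (by simp)]; simp
  | cons x L ih =>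
    rw [antisymm_cons]
    rcases p with _ | p
    · have e : insertOp x f = (0 : ℂ) • f := by
        refine ext_apply fun L => ?_; rw [hf.insertOp_apply, hp _ (by simp)]; simp
      rw [e, antisymm_smul, hp _ (by simp)]; simp
    · have e : insertOp x f = ((p : ℂ) + 1) • contract x f := by
        refine ext_apply fun L => ?_
        rw [hf.insertOp_apply]
        by_cases h : L.length = p
        · simp [h]
        · simp [hp (x :: L) (by simpa using h)]
      rw [e, antisymm_smul, ih (hf.contract x) (hp.contract x), contract_apply,
        Nat.factorial_succ]
      push_cast
      ring

theorem sum_insertIdx (x : g) {N : ℕ} (Y : Fin N → g) (f : ListForm g) :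
    ∑ j : Fin (N + 1), (-1 : ℂ) ^ (j : ℕ) * f ((List.ofFn Y).insertIdx j x)
      = insertOp x f (List.ofFn Y) := by
  induction N generalizing f with
  | zero => simp [insertOp_nil]
  | succ N ih =>
    rw [Fin.sum_univ_succ, List.ofFn_succ, insertOp_cons, ← ih]
    simp [pow_succ, Finset.sum_neg_distrib, sub_eq_add_neg]

end Shuffle

section Differential

variable {g : Type} [LieRing g]

/-- Lie derivative of a raw form, acting as a derivation on each slot. -/
noncomputable def lieSum (x : g) : List g → ListForm g → ℂ
  | [], _ => 0
  | y :: L, f => lieSum x L (contract y f) - f (⁅x, y⁆ :: L)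

/-- The Lie derivative along `x`. -/
noncomputable def lieDeriv (x : g) (f : ListForm g) : ListForm g := ⟨fun L => lieSum x L f⟩

theorem lieDeriv_nil (x : g) (f : ListForm g) : lieDeriv x f [] = 0 := rfl

theorem lieDeriv_cons (x y : g) (f : ListForm g) (L : List g) :
    lieDeriv x f (y :: L) = lieDeriv x (contract y f) L - f (⁅x, y⁆ :: L) := rfl

theorem contract_lieDeriv (x y : g) (f : ListForm g) :
    contract y (lieDeriv x f) = lieDeriv x (contract y f) - contract ⁅x, y⁆ f := rfl

theorem lieDeriv_add (x : g) (L : List g) : ∀ a b : ListForm g,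
    lieDeriv x (a + b) L = lieDeriv x a L + lieDeriv x b L := by
  induction L with
  | nil => intro a b; simp [lieDeriv_nil]
  | cons y L ih => intro a b; simp only [lieDeriv_cons, map_add, ih, add_apply]; ring

theorem lieDeriv_smul (x : g) (L : List g) : ∀ (r : ℂ) (a : ListForm g),
    lieDeriv x (r • a) L = r * lieDeriv x a L := by
  induction L with
  | nil => intro r a; simp [lieDeriv_nil]
  | cons y L ih => intro r a; simp only [lieDeriv_cons, map_smul, ih, smul_apply]; ring

theorem lieDeriv_neg (x : g) (a : ListForm g) : lieDeriv x (-a) = -lieDeriv x a := by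
  refine ext_apply fun L => ?_
  simpa using lieDeriv_smul x L (-1) a

theorem lieDeriv_parity (x : g) (L : List g) : ∀ a : ListForm g,
    lieDeriv x (parity a) L = parity (lieDeriv x a) L := by
  induction L with
  | nil => intro a; simp [lieDeriv_nil]
  | cons y L ih =>
    intro a
    rw [lieDeriv_cons, contract_parity, lieDeriv_neg, neg_apply, ih]
    simp only [parity_apply, List.length_cons, lieDeriv_cons]
    ring

theorem lieDeriv_mul_apply (x : g) (L : List g) : ∀ a b : ListForm g,
    lieDeriv x (a * b) L = (lieDeriv x a * b) L + (a * lieDeriv x b) L := by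
  induction L with
  | nil => intro a b; simp [lieDeriv_nil, mul_nil]
  | cons y L ih =>
    intro a b
    have e : lieDeriv x (parity a) = parity (lieDeriv x a) :=
      ext_apply fun L => lieDeriv_parity x L a
    have e3 : (a * b) (⁅x, y⁆ :: L)
      = (contract ⁅x, y⁆ a * b) L + (parity a * contract ⁅x, y⁆ b) L := rfl
    rw [lieDeriv_cons, e3, contract_mul, lieDeriv_add, ih, ih, e]
    simp only [mul_cons, contract_lieDeriv, sub_mul, mul_sub, sub_apply]
    ring

/-- The Chevalley–Eilenberg differential, characterised by Cartan's formula
`ι_x d = L_x - d ι_x`. -/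
noncomputable def dSum : List g → ListForm g → ℂ
  | [], _ => 0
  | x :: L, f => lieDeriv x f L - dSum L (contract x f)

theorem dSum_add (L : List g) : ∀ a b : ListForm g, dSum L (a + b) = dSum L a + dSum L b := by
  induction L with
  | nil => intro a b; simp [dSum]
  | cons y L ih => intro a b; simp only [dSum, map_add, ih, lieDeriv_add]; ring

theorem dSum_smul (L : List g) : ∀ (r : ℂ) (a : ListForm g), dSum L (r • a) = r * dSum L a := by
  induction L with
  | nil => intro r a; simp [dSum]
  | cons y L ih => intro r a; simp only [dSum, map_smul, ih, lieDeriv_smul]; ring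

/-- The Chevalley–Eilenberg differential as a linear operator. -/
noncomputable def diff : ListForm g →ₗ[ℂ] ListForm g where
  toFun f := ⟨fun L => dSum L f⟩
  map_add' a b := ext_apply fun L => dSum_add L a b
  map_smul' r a := ext_apply fun L => dSum_smul L r a

theorem diff_nil (f : ListForm g) : diff f [] = 0 := rfl

theorem diff_cons (f : ListForm g) (x : g) (L : List g) :
    diff f (x :: L) = lieDeriv x f L - diff (contract x f) L := rfl

theorem contract_diff (f : ListForm g) (x : g) :
    contract x (diff f) = lieDeriv x f - diff (contract x f) := rfl

theorem parity_diff_apply (L : List g) : ∀ f : ListForm g,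
    parity (diff f) L = -diff (parity f) L := by
  induction L with
  | nil => intro f; simp [diff_nil]
  | cons x L ih =>
    intro f
    rw [diff_cons, contract_parity, map_neg, lieDeriv_parity, neg_apply, ← ih]
    simp only [parity_apply, List.length_cons, diff_cons]
    ring

theorem parity_diff (f : ListForm g) : parity (diff f) = -diff (parity f) :=
  ext_apply fun L => parity_diff_apply L f

theorem diff_mul_apply (L : List g) : ∀ a b : ListForm g,
    diff (a * b) L = (diff a * b) L + (parity a * diff b) L := by
  induction L with
  | nil => intro a b; simp [diff_nil, mul_nil]
  | cons x L ih =>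
    intro a b
    rw [diff_cons, contract_mul, map_add, add_apply, ih, ih, lieDeriv_mul_apply]
    simp only [mul_cons, contract_diff, sub_mul, mul_sub, sub_apply, parity_diff, contract_parity,
      neg_mul, neg_apply, parity_parity]
    ring

theorem diff_mul (a b : ListForm g) : diff (a * b) = diff a * b + parity a * diff b :=
  ext_apply fun L => diff_mul_apply L a b

theorem diff_pow_succ {a : ListForm g} (ha : parity a = a) (k : ℕ) :
    diff (a ^ (k + 1)) = ((k : ℂ) + 1) • (diff a * a ^ k) := by
  induction k with
  | zero => simp
  | succ k ih =>
    rw [pow_succ', diff_mul, ih, ha, mul_smul_comm, ← mul_assoc, commute_of_parity_eq ha,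
      mul_assoc, ← pow_succ']
    push_cast
    module

/-- The form `ddᶜ(ω^k) ∧ ω^m` for a `J`-invariant `2`-form, expanded by the Leibniz rule. -/
theorem diff_diff_pow_mul_pow {a b : ListForm g} (ha : parity a = a) (hb : parity b = -b)
    (k m : ℕ) :
    diff (((k : ℂ) + 1) • (b * a ^ k)) * a ^ m
      = ((k : ℂ) + 1) • (diff b * a ^ (k + m))
        - (((k : ℂ) + 1) * k) • (b * (diff a * a ^ (k + m - 1))) := by
  have h : diff (b * a ^ k) * a ^ m
      = diff b * a ^ (k + m) - (k : ℂ) • (b * (diff a * a ^ (k + m - 1))) := by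
    rcases k with _ | k
    · simp
    · rw [diff_mul, hb, diff_pow_succ ha, show k + 1 + m - 1 = k + m by omega, pow_add a (k + 1) m,
        pow_add a k m]
      simp only [neg_mul, add_mul, mul_smul_comm, smul_mul_assoc, mul_assoc]
      push_cast
      module
  rw [map_smul, smul_mul_assoc, h]
  module

/-- Oddness in each argument. -/
def NegArg (f : ListForm g) : Prop :=
  ∀ (L : List g) (x : g) (M : List g), f (L ++ (-x) :: M) = -f (L ++ x :: M)

theorem NegArg.contract {f : ListForm g} (hf : NegArg f) (x : g) :
    NegArg (contract x f) := fun L => hf (x :: L)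

theorem NegArg.smul {f : ListForm g} (hf : NegArg f) (c : ℂ) : NegArg (c • f) := by
  intro L x M; simp [hf L x M]

theorem NegArg.parity {f : ListForm g} (hf : NegArg f) : NegArg (parity f) := by
  intro L x M; simp [hf L x M]

theorem NegArg.contract_neg {f : ListForm g} (hf : NegArg f) (x : g) :
    ListForm.contract (-x) f = -ListForm.contract x f :=
  ext_apply fun L => hf [] x L

theorem NegArg.mul {f h : ListForm g} (hf : NegArg f) (hh : NegArg h) : NegArg (f * h) := by
  intro L x M
  induction L generalizing f h with
  | nil =>
    simp only [List.nil_append, mul_cons, hf.contract_neg, hh.contract_neg, neg_mul, mul_neg,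
      neg_apply]
    ring
  | cons z L ih =>
    simp only [List.cons_append, mul_cons]
    rw [ih (hf.contract z) hh, ih hf.parity (hh.contract z)]
    ring

theorem NegArg.one : NegArg (1 : ListForm g) := by
  intro L x M
  cases L <;> simp [one_cons]

theorem NegArg.pow {f : ListForm g} (hf : NegArg f) (k : ℕ) : NegArg (f ^ k) := by
  induction k with
  | zero => simpa using NegArg.one
  | succ k ih => rw [pow_succ]; exact ih.mul hf

theorem NegArg.lieDeriv {f : ListForm g} (hf : NegArg f) (z : g) : NegArg (lieDeriv z f) := by
  intro L x M
  induction L generalizing f with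
  | nil =>
    have := hf [] ⁅z, x⁆ M
    simp only [List.nil_append] at this
    simp only [List.nil_append, lieDeriv_cons, hf.contract_neg, lieDeriv_neg, neg_apply, lie_neg,
      this]
    ring
  | cons y L ih =>
    have := hf (⁅z, y⁆ :: L) x M
    simp only [List.cons_append] at this
    simp only [List.cons_append, lieDeriv_cons, ih (hf.contract y), this]
    ring

theorem NegArg.lieDeriv_neg_left {f : ListForm g} (hf : NegArg f) (x : g) (L : List g) :
    ListForm.lieDeriv (-x) f L = -ListForm.lieDeriv x f L := by
  induction L generalizing f with
  | nil => simp [lieDeriv_nil]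
  | cons y L ih =>
    have := hf [] ⁅x, y⁆ L
    simp only [List.nil_append] at this
    simp only [lieDeriv_cons, ih (hf.contract y), neg_lie, this]
    ring

theorem NegArg.diff {f : ListForm g} (hf : NegArg f) : NegArg (diff f) := by
  intro L x M
  induction L generalizing f with
  | nil =>
    simp only [List.nil_append, diff_cons, hf.contract_neg, map_neg, hf.lieDeriv_neg_left,
      neg_apply]
    ring
  | cons y L ih =>
    have := hf.lieDeriv y L x M
    simp only [List.cons_append, diff_cons, ih (hf.contract y), this]
    ring

theorem SwapNeg.lieDeriv {f : ListForm g} (hf : SwapNeg f) (z : g) :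
    SwapNeg (lieDeriv z f) := by
  intro L x y M
  induction L generalizing f with
  | nil =>
    have h1 := hf [] ⁅z, x⁆ y M
    have h2 := hf [] ⁅z, y⁆ x M
    simp only [List.nil_append] at h1 h2
    simp only [List.nil_append, lieDeriv_cons, hf.contract_contract x y, lieDeriv_neg, neg_apply,
      contract_apply, h1, h2]
    ring
  | cons w L ih =>
    have := hf (⁅z, w⁆ :: L) x y M
    simp only [List.cons_append] at this
    simp only [List.cons_append, lieDeriv_cons, ih (hf.contract w), this]
    ring

theorem SwapNeg.diff {f : ListForm g} (hf : SwapNeg f) (hn : NegArg f) : SwapNeg (diff f) := by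
  intro L x y M
  induction L generalizing f with
  | nil =>
    have h1 := hn [] ⁅x, y⁆ M
    simp only [List.nil_append, lie_skew] at h1
    simp only [List.nil_append, lieDeriv_cons, diff_cons, hf.contract_contract x y, map_neg,
      neg_apply, h1]
    ring
  | cons w L ih =>
    have := hf.lieDeriv w L x y M
    simp only [List.cons_append, diff_cons, ih (hf.contract w) (hn.contract w), this]
    ring

theorem Homog.lieDeriv {p : ℕ} {f : ListForm g} (hf : Homog p f) (x : g) :
    Homog p (lieDeriv x f) := by
  intro L hL
  induction L generalizing p f with
  | nil => rfl
  | cons y L ih =>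
    rw [lieDeriv_cons, hf _ (by simpa using hL), sub_zero]
    rcases p with _ | p
    · rw [hf.contract_zero]
      simpa using lieDeriv_smul x L 0 0
    · exact ih (hf.contract y) (by simpa using hL)

theorem Homog.diff {p : ℕ} {f : ListForm g} (hf : Homog p f) : Homog (p + 1) (diff f) := by
  intro L hL
  induction L generalizing p f with
  | nil => rfl
  | cons x L ih =>
    rw [diff_cons, hf.lieDeriv x _ (by simpa using hL)]
    rcases p with _ | p
    · rw [hf.contract_zero]
      simp
    · rw [ih (hf.contract x) (by simpa using hL)]
      simp

theorem SwapNeg.sum_lie_eraseIdx {f : ListForm g} (hf : SwapNeg f) (x : g) {N : ℕ}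
    (Y : Fin N → g) :
    ∑ j : Fin N, (-1 : ℂ) ^ ((j : ℕ) + 1) * f (⁅x, Y j⁆ :: (List.ofFn Y).eraseIdx j)
      = ListForm.lieDeriv x f (List.ofFn Y) := by
  induction N generalizing f with
  | zero => simp [lieDeriv_nil]
  | succ N ih =>
    rw [Fin.sum_univ_succ, List.ofFn_succ, lieDeriv_cons, ← ih (hf.contract (Y 0))]
    have h : ∀ j : Fin N,
        f (⁅x, Y j.succ⁆ :: Y 0 :: (List.ofFn fun i => Y i.succ).eraseIdx j)
        = -f (Y 0 :: ⁅x, Y j.succ⁆ :: (List.ofFn fun i => Y i.succ).eraseIdx j) :=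
      fun j => hf [] _ _ _
    simp only [Fin.val_zero, Fin.val_succ, List.eraseIdx_cons_zero, List.eraseIdx_cons_succ, h,
      contract_apply, pow_succ]
    simp
    ring

theorem SwapNeg.sum_sum_lie_eraseIdx {f : ListForm g} (hf : SwapNeg f) {N : ℕ}
    (X : Fin N → g) :
    ∑ i : Fin N, ∑ j : Fin N, (if (i : ℕ) < (j : ℕ) then (-1 : ℂ) ^ ((i : ℕ) + (j : ℕ)) *
        f (⁅X i, X j⁆ :: ((List.ofFn X).eraseIdx j).eraseIdx i) else 0)
      = ListForm.diff f (List.ofFn X) := by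
  induction N generalizing f with
  | zero => simp [diff_nil]
  | succ N ih =>
    rw [Fin.sum_univ_succ, List.ofFn_succ, diff_cons, ← ih (hf.contract (X 0)),
      ← hf.sum_lie_eraseIdx, sub_eq_add_neg, ← Finset.sum_neg_distrib]
    congr 1
    · rw [Fin.sum_univ_succ]
      simp
    · refine Finset.sum_congr rfl fun i _ => ?_
      rw [Fin.sum_univ_succ, ← Finset.sum_neg_distrib]
      simp only [Fin.val_zero, Fin.val_succ, not_lt_zero, if_false, zero_add, add_lt_add_iff_right,
        List.eraseIdx_cons_succ]
      refine Finset.sum_congr rfl fun j _ => ?_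
      have h := hf [] ⁅X i.succ, X j.succ⁆ (X 0)
        (((List.ofFn fun i => X i.succ).eraseIdx j).eraseIdx i)
      simp only [List.nil_append] at h
      split_ifs
      · rw [h, contract_apply]; ring
      · simp

end Differential

section Pullback

variable {g : Type}

/-- Pullback of a raw form along a self-map. -/
noncomputable def pullback (J : g → g) : ListForm g →ₗ[ℂ] ListForm g where
  toFun f := ⟨fun L => f (L.map J)⟩
  map_add' _ _ := rfl
  map_smul' _ _ := rfl

theorem pullback_apply (J : g → g) (f : ListForm g) (L : List g) :
    pullback J f L = f (L.map J) := rfl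

theorem parity_pullback (J : g → g) (f : ListForm g) :
    parity (pullback J f) = pullback J (parity f) :=
  ext_apply fun L => by simp [pullback_apply]

theorem pullback_mul (J : g → g) (a b : ListForm g) :
    pullback J (a * b) = pullback J a * pullback J b := by
  refine ext_apply fun L => ?_
  induction L generalizing a b with
  | nil => rfl
  | cons x L ih =>
    have h1 := ih (contract (J x) a) b
    have h2 := ih (parity a) (contract (J x) b)
    rw [← parity_pullback] at h2
    calc pullback J (a * b) (x :: L)
        = pullback J (contract (J x) a * b) L + pullback J (parity a * contract (J x) b) L := rfl
      _ = _ := by rw [h1, h2]; rfl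

theorem pullback_one (J : g → g) : pullback J (1 : ListForm g) = 1 :=
  ext_apply fun L => by cases L <;> rfl

theorem pullback_pow (J : g → g) (a : ListForm g) (k : ℕ) :
    pullback J (a ^ k) = pullback J a ^ k := by
  induction k with
  | zero => simp [pullback_one]
  | succ k ih => rw [pow_succ, pow_succ, pullback_mul, ih]

theorem SwapNeg.pullback {f : ListForm g} (hf : SwapNeg f) (J : g → g) :
    SwapNeg (pullback J f) := by
  intro L x y M
  simpa [pullback_apply] using hf (L.map J) (J x) (J y) (M.map J)

theorem Homog.pullback {p : ℕ} {f : ListForm g} (hf : Homog p f) (J : g → g) :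
    Homog p (pullback J f) := fun L hL => hf _ (by simpa using hL)

end Pullback

theorem NegArg.pullback {g : Type} [LieRing g] {f : ListForm g} (hf : NegArg f) {J : g → g} (hJ : ∀ x, J (-x) = -J x) :
    NegArg (pullback J f) := by
  intro L x M
  simpa [pullback_apply, hJ] using hf (L.map J) (J x) (M.map J)

section OfRaw

variable {g : Type}

theorem sum_perm_succ {M : Type*} [AddCommMonoid M] {N : ℕ}
    (F : Equiv.Perm (Fin (N + 1)) → M) :
    ∑ σ, F σ = ∑ e : Equiv.Perm (Fin N), ∑ j : Fin (N + 1),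
      F (Equiv.Perm.decomposeFin.symm (0, e) * j.cycleRange) := by
  rw [← Fintype.sum_prod_type']
  symm
  refine Fintype.sum_bijective
    (fun q : Equiv.Perm (Fin N) × Fin (N + 1) =>
      Equiv.Perm.decomposeFin.symm (0, q.1) * q.2.cycleRange) ?_ _ _ fun _ => rfl
  refine (Fintype.bijective_iff_injective_and_card _).2 ⟨?_, ?_⟩
  · rintro ⟨e, j⟩ ⟨e', j'⟩ h
    have hz : ∀ (e : Equiv.Perm (Fin N)) (j : Fin (N + 1)),
        (Equiv.Perm.decomposeFin.symm (0, e) * j.cycleRange) j = 0 := by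
      intro e j; simp
    have hj : j = j' := by
      apply (Equiv.Perm.decomposeFin.symm (0, e') * j'.cycleRange).injective
      exact ((Equiv.congr_fun h j).symm.trans (hz e j)).trans (hz e' j').symm
    subst hj
    have := mul_right_cancel h
    simpa using this
  · simp [Fintype.card_perm, Nat.factorial_succ, mul_comm]

theorem ofFn_insertNth {N : ℕ} (j : Fin (N + 1)) (x : g) (Y : Fin N → g) :
    List.ofFn (j.insertNth x Y : Fin (N + 1) → g) = (List.ofFn Y).insertIdx j x := by
  induction N with
  | zero =>
    have : j = 0 := Fin.eq_zero j
    subst this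
    simp
  | succ N ih =>
    refine Fin.cases ?_ (fun j => ?_) j
    · simp [List.ofFn_succ]
    · rw [List.ofFn_succ, List.ofFn_succ (f := Y), Fin.val_succ, List.insertIdx_succ_cons, ← ih]
      congr 1
      congr 1
      funext i
      refine Fin.succAboveCases j ?_ (fun i => ?_) i
      · simp
      · rw [Fin.insertNth_apply_succAbove, ← Fin.succ_succAbove_succ,
          Fin.insertNth_apply_succAbove]

theorem sum_sign_perm (f : ListForm g) {N : ℕ} (X : Fin N → g) :
    ∑ σ : Equiv.Perm (Fin N), ((Equiv.Perm.sign σ : ℤ) : ℂ) * f (List.ofFn fun i => X (σ i))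
      = antisymm f (List.ofFn X) := by
  induction N generalizing f with
  | zero => simp [antisymm_nil]
  | succ N ih =>
    rw [sum_perm_succ, List.ofFn_succ, antisymm_cons, ← ih]
    refine Finset.sum_congr rfl fun e _ => ?_
    rw [← sum_insertIdx, Finset.mul_sum]
    refine Finset.sum_congr rfl fun j _ => ?_
    have h : (fun i => X ((Equiv.Perm.decomposeFin.symm (0, e) * j.cycleRange) i))
        = j.insertNth (X 0) (fun i => X (e i).succ) := by
      rw [← Fin.cons_comp_cycleRange]
      funext i
      simp only [Equiv.Perm.mul_apply, Function.comp_apply]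
      refine Fin.cases ?_ (fun k => ?_) (j.cycleRange i) <;> simp
    rw [h, ofFn_insertNth]
    simp [Fin.sign_cycleRange, mul_assoc]

/-- A raw `p`-form, as a form concentrated on lists of length `p`. -/
noncomputable def ofRaw {p : ℕ} (η : (Fin p → g) → ℂ) : ListForm g :=
  ⟨fun L => if h : L.length = p then η (fun i => L.get (i.cast h.symm)) else 0⟩

theorem ofRaw_ofFn {p : ℕ} (η : (Fin p → g) → ℂ) (X : Fin p → g) :
    ofRaw η (List.ofFn X) = η X := by
  simp [ofRaw]

theorem ofRaw_homog {p : ℕ} (η : (Fin p → g) → ℂ) : Homog p (ofRaw η) :=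
  fun _ hL => dif_neg hL

theorem ext_of_homog {p : ℕ} {f h : ListForm g} (hf : Homog p f) (hh : Homog p h)
    (H : ∀ X : Fin p → g, f (List.ofFn X) = h (List.ofFn X)) : f = h := by
  refine ext_apply fun L => ?_
  by_cases hL : L.length = p
  · subst hL
    simpa using H L.get
  · rw [hf L hL, hh L hL]

theorem ofRaw_eq_zero_iff {p : ℕ} (η : (Fin p → g) → ℂ) : ofRaw η = 0 ↔ η = 0 := by
  constructor
  · intro h
    funext X
    rw [← ofRaw_ofFn η X, h]
    rfl
  · rintro rfl
    refine ext_apply fun L => ?_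
    simp [ofRaw]

theorem tensor_ofRaw_two (ω : (Fin 2 → g) → ℂ) (f : ListForm g) (a b : g) (L : List g) :
    tensor (ofRaw ω) f (a :: b :: L) = ω ![a, b] * f L := by
  have h := tensor_append (ofRaw_homog ω) f [a, b] L rfl
  have h' := ofRaw_ofFn ω ![a, b]
  simp only [List.ofFn_succ, List.ofFn_zero] at h'
  rw [← h']
  exact h

theorem ofRaw_pair (ω : (Fin 2 → g) → ℂ) (a b : g) : ofRaw ω [a, b] = ω ![a, b] := by
  simpa [List.ofFn_succ] using ofRaw_ofFn ω ![a, b]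

end OfRaw

section Bridge

variable {g : Type} [LieRing g] [LieAlgebra ℝ g]

theorem ofRaw_wedge {p q : ℕ} {α : (Fin p → g) → ℂ} {β : (Fin q → g) → ℂ}
    (hα : SwapNeg (ofRaw α)) (hβ : SwapNeg (ofRaw β)) :
    ofRaw (wedge α β) = ofRaw α * ofRaw β := by
  have hA : ∀ {p : ℕ} {α : (Fin p → g) → ℂ}, SwapNeg (ofRaw α) →
      antisymm (ofRaw α) = (p.factorial : ℂ) • ofRaw α := fun h =>
    ext_apply fun L => antisymm_of_swapNeg h (ofRaw_homog _) L
  have hT := antisymm_tensor (ofRaw α) (ofRaw β)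
  rw [hA hα, hA hβ, smul_mul_smul_comm] at hT
  have hp : (p.factorial : ℂ) * q.factorial ≠ 0 := by
    exact_mod_cast (Nat.mul_pos p.factorial_pos q.factorial_pos).ne'
  have hM : ofRaw α * ofRaw β
      = ((p.factorial : ℂ) * q.factorial)⁻¹ • antisymm (tensor (ofRaw α) (ofRaw β)) := by
    rw [hT, smul_smul, inv_mul_cancel₀ hp, one_smul]
  have hS : ∀ {N : ℕ} (X : Fin N → g), antisymm (tensor (ofRaw α) (ofRaw β)) (List.ofFn X)
      = ∑ σ : Equiv.Perm (Fin N), ((Equiv.Perm.sign σ : ℤ) : ℂ) *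
        tensor (ofRaw α) (ofRaw β) (List.ofFn fun i => X (σ i)) :=
    fun X => (sum_sign_perm _ X).symm
  have key : ∀ X : Fin (p + q) → g, ofRaw (wedge α β) (List.ofFn X)
      = (ofRaw α * ofRaw β) (List.ofFn X) := by
    intro X
    rw [ofRaw_ofFn, hM, smul_apply, hS, wedge]
    congr 1
    refine Finset.sum_congr rfl fun σ _ => ?_
    rw [List.ofFn_add, tensor_append (ofRaw_homog α) _ _ _ (by simp), ofRaw_ofFn, ofRaw_ofFn,
      mul_assoc]
    rfl
  exact ext_of_homog (ofRaw_homog _) ((ofRaw_homog α).mul (ofRaw_homog β)) key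

theorem ofRaw_ceD {p : ℕ} {η : (Fin p → g) → ℂ} (hη : SwapNeg (ofRaw η)) :
    ofRaw (ceD η) = diff (ofRaw η) := by
  refine ext_of_homog (ofRaw_homog _) (ofRaw_homog η).diff fun X => ?_
  rw [ofRaw_ofFn, ← hη.sum_sum_lie_eraseIdx, ceD]
  refine Finset.sum_congr rfl fun i _ => Finset.sum_congr rfl fun j _ => ?_
  split_ifs with hij
  · rw [← ofRaw_ofFn η]
    congr 2
    have hj := j.isLt
    refine List.ext_getElem ?_ fun k h1 h2 => ?_
    · simp only [List.length_ofFn, List.length_cons, List.length_eraseIdx]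
      split_ifs <;> omega
    · rcases k with _ | k
      · simp
      · simp only [List.getElem_ofFn, List.getElem_cons_succ, List.getElem_eraseIdx]
        simp only [Nat.add_eq_zero_iff, one_ne_zero, and_false, dite_false, skipTwo,
          Nat.add_sub_cancel]
        by_cases hi : k < i
        · simp [hi, hi.trans hij]
        · by_cases hj' : k + 1 < j
          · simp [hi, hj']
          · simp [hi, hj']
  · rfl

theorem ofRaw_Jact (J : g →ₗ[ℝ] g) {p : ℕ} (η : (Fin p → g) → ℂ) :
    ofRaw (Jact J η) = (-1 : ℂ) ^ p • pullback J (ofRaw η) := by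
  refine ext_of_homog (ofRaw_homog _)
    (fun L hL => by rw [smul_apply, (ofRaw_homog η).pullback J L hL, mul_zero]) fun X => ?_
  rw [ofRaw_ofFn, smul_apply, pullback_apply, List.map_ofFn, ofRaw_ofFn, Jact]
  rfl

theorem ofRaw_dcD (J : g →ₗ[ℝ] g) {p : ℕ} {η : (Fin p → g) → ℂ} (hη : SwapNeg (ofRaw η)) :
    ofRaw (dcD J η) = (-1 : ℂ) ^ (p + 1) • pullback J (diff (pullback J (ofRaw η))) := by
  have h1 : ofRaw (dcD J η) = (-1 : ℂ) ^ p • ofRaw (Jact J (ceD (Jact J η))) := by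
    refine ext_of_homog (ofRaw_homog _)
      (fun L hL => by rw [smul_apply, ofRaw_homog _ L hL, mul_zero]) fun X => ?_
    rw [ofRaw_ofFn, smul_apply, ofRaw_ofFn, dcD]
  have h2 : SwapNeg (ofRaw (Jact J η)) := by
    rw [ofRaw_Jact]; exact (hη.pullback J).smul _
  rw [h1, ofRaw_Jact, ofRaw_ceD h2, ofRaw_Jact, map_smul, map_smul, smul_smul, smul_smul]
  congr 1
  rw [pow_succ, mul_assoc, mul_assoc, mul_comm ((-1 : ℂ) ^ p) (_ * _), mul_assoc, mul_assoc,
    ← pow_add, ← two_mul, pow_mul]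
  simp

theorem ofRaw_wpow {ω : (Fin 2 → g) → ℂ} (hω : SwapNeg (ofRaw ω)) (k : ℕ) :
    ofRaw (wpow ω k) = ofRaw ω ^ k := by
  let T : ℕ → ListForm g := fun k => (tensor (ofRaw ω))^[k] 1
  have hT : ∀ (k : ℕ) (Y : Fin (2 * k) → g), T k (List.ofFn Y)
      = ∏ t : Fin k, ω (fun s => Y ⟨2 * (t : ℕ) + (s : ℕ), by omega⟩) := by
    intro k
    induction k with
    | zero => intro Y; simp [T, one_nil]
    | succ k ih =>
      intro Y
      have e : T (k + 1) = tensor (ofRaw ω) (T k) := Function.iterate_succ_apply' _ _ _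
      have eY : List.ofFn Y = Y ⟨0, by omega⟩ :: Y ⟨1, by omega⟩ ::
          List.ofFn (fun i : Fin (2 * k) => Y ⟨(i : ℕ) + 2, by omega⟩) := by
        have : ∀ {N : ℕ} (Y : Fin (N + 2) → g), List.ofFn Y = Y ⟨0, by omega⟩ ::
            Y ⟨1, by omega⟩ :: List.ofFn (fun i : Fin N => Y ⟨(i : ℕ) + 2, by omega⟩) := by
          intro N Y
          rw [List.ofFn_succ, List.ofFn_succ]
          rfl
        exact this Y
      rw [e, eY, tensor_ofRaw_two, ih, Fin.prod_univ_succ]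
      congr 1
      · congr 1
        funext s
        fin_cases s <;> rfl
      · refine Finset.prod_congr rfl fun t _ => congrArg ω (funext fun s => congrArg Y ?_)
        ext
        simp only [Fin.val_succ]
        ring
  have hA : ∀ k, antisymm (T k) = (2 : ℂ) ^ k • ofRaw ω ^ k := by
    intro k
    induction k with
    | zero =>
      refine ext_apply fun L => ?_
      have h1 : Homog 0 (1 : ListForm g) := fun L hL => by
        cases L with
        | nil => simp at hL
        | cons x L => rfl
      simpa [T] using antisymm_of_swapNeg SwapNeg.one h1 L
    | succ k ih =>
      have e : T (k + 1) = tensor (ofRaw ω) (T k) := Function.iterate_succ_apply' _ _ _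
      have e2 : antisymm (ofRaw ω) = (2 : ℂ) • ofRaw ω := ext_apply fun L => by
        simpa using antisymm_of_swapNeg hω (ofRaw_homog ω) L
      rw [e, antisymm_tensor, ih, e2, smul_mul_smul_comm, ← pow_succ', ← pow_succ']
  have hp : Homog (2 * k) (ofRaw ω ^ k) := by
    induction k with
    | zero =>
      intro L hL
      cases L with
      | nil => simp at hL
      | cons x L => rfl
    | succ k ih => rw [pow_succ]; exact ih.mul (ofRaw_homog ω)
  refine ext_of_homog (ofRaw_homog _) hp fun X => ?_
  have h2 : (2 : ℂ) ^ k ≠ 0 := pow_ne_zero _ two_ne_zero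
  have e : ofRaw ω ^ k = ((2 : ℂ) ^ k)⁻¹ • antisymm (T k) := by
    rw [hA, smul_smul, inv_mul_cancel₀ h2, one_smul]
  rw [ofRaw_ofFn, e, smul_apply, ← sum_sign_perm, wpow]
  congr 1
  exact Finset.sum_congr rfl fun σ _ => by rw [hT]

theorem swapNeg_ofRaw_alternating (ω : AlternatingMap ℝ g ℂ (Fin 2)) :
    SwapNeg (ofRaw fun v => ω v) := by
  intro L x y M
  by_cases h : L = [] ∧ M = []
  · obtain ⟨rfl, rfl⟩ := h
    rw [List.nil_append, List.nil_append, ofRaw_pair, ofRaw_pair]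
    have := ω.map_swap ![x, y] (show (0 : Fin 2) ≠ 1 by decide)
    have e : ![x, y] ∘ Equiv.swap (0 : Fin 2) 1 = ![y, x] := by
      funext i
      fin_cases i <;> rfl
    rw [← e, this, neg_neg]
  · have hl : L.length + M.length ≠ 0 := by
      simpa [List.length_eq_zero_iff] using h
    rw [ofRaw_homog _ _ (by simp; omega), ofRaw_homog _ _ (by simp; omega), neg_zero]

theorem negArg_ofRaw_alternating (ω : AlternatingMap ℝ g ℂ (Fin 2)) :
    NegArg (ofRaw fun v => ω v) := by
  intro L x M
  by_cases h : L.length + (M.length + 1) = 2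
  · rcases L with _ | ⟨a, _ | ⟨b, L⟩⟩
    · obtain ⟨b, rfl⟩ : ∃ b, M = [b] := List.length_eq_one_iff.1 (by simpa using h)
      rw [List.nil_append, List.nil_append, ofRaw_pair, ofRaw_pair]
      have e : ∀ z, ![z, b] = Function.update ![x, b] 0 z := by
        intro z; funext i; fin_cases i <;> rfl
      rw [e (-x), ω.map_update_neg, ← e x]
    · obtain rfl : M = [] := List.length_eq_zero_iff.1 (by simp at h; omega)
      rw [List.singleton_append, List.singleton_append, ofRaw_pair, ofRaw_pair]
      have e : ∀ z, ![a, z] = Function.update ![a, x] 1 z := by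
        intro z; funext i; fin_cases i <;> rfl
      rw [e (-x), ω.map_update_neg, ← e x]
    · simp at h
      omega
  · rw [ofRaw_homog _ _ (by simpa using h), ofRaw_homog _ _ (by simpa using h), neg_zero]

end Bridge

end ListForm

/-- Let `𝔤` be a real Lie algebra of dimension `2n`, `n ≥ 3`, with complex
structure `J`, and `ω` a positive `(1,1)`-form.  If `ω` is `k₁`-Gauduchon and `k₂`-Gauduchon
for some `1 ≤ k₁ < k₂ ≤ n−1`, then `ω` is `k`-Gauduchon for every `1 ≤ k ≤ n−1`; in particular
`ddᶜ(ω^{n−1}) = 0` (`ω` is Gauduchon), `ddᶜω ∧ ω^{n−2} = 0` and `dᶜω ∧ dω ∧ ω^{n−3} = 0`. -/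
theorem statement4 (n k₁ k₂ : ℕ) (hn : 3 ≤ n) (hk1 : 1 ≤ k₁) (hk12 : k₁ < k₂) (hk2 : k₂ ≤ n - 1)
    (g : Type) [LieRing g] [LieAlgebra ℝ g] [FiniteDimensional ℝ g]
    (hdim : Module.finrank ℝ g = 2 * n)
    (J : g →ₗ[ℝ] g)
    (hJ2 : ∀ x, J (J x) = -x)
    (hJi : ∀ x y : g, J ⁅x, y⁆ - ⁅J x, y⁆ - ⁅x, J y⁆ - J ⁅J x, J y⁆ = 0)
    (ω : AlternatingMap ℝ g ℂ (Fin 2))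
    (hreal : ∀ v, (ω v).im = 0)
    (h11 : ∀ v : Fin 2 → g, ω (fun i => J (v i)) = ω v)
    (hpos : ∀ x : g, x ≠ 0 → 0 < (ω ![x, J x]).re)
    (hG1 : wedge (ceD (dcD J (wpow (fun v => ω v) k₁))) (wpow (fun v => ω v) (n - k₁ - 1)) = 0)
    (hG2 : wedge (ceD (dcD J (wpow (fun v => ω v) k₂))) (wpow (fun v => ω v) (n - k₂ - 1)) = 0) :
    (∀ k : ℕ, 1 ≤ k → k ≤ n - 1 →
      wedge (ceD (dcD J (wpow (fun v => ω v) k))) (wpow (fun v => ω v) (n - k - 1)) = 0) ∧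
    ceD (dcD J (wpow (fun v => ω v) (n - 1))) = 0 ∧
    wedge (ceD (dcD J (fun v => ω v))) (wpow (fun v => ω v) (n - 2)) = 0 ∧
    wedge (dcD J (fun v => ω v))
      (wedge (ceD (fun v => ω v)) (wpow (fun v => ω v) (n - 3))) = 0 := by
  set W : ListForm g := ListForm.ofRaw fun v => ω v with hW
  have sW : ListForm.SwapNeg W := ListForm.swapNeg_ofRaw_alternating ω
  have nW : ListForm.NegArg W := ListForm.negArg_ofRaw_alternating ω
  have pW : ListForm.parity W = W := by
    rw [hW, (ListForm.ofRaw_homog _).parity]; norm_num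
  have jW : ListForm.pullback J W = W :=
    ListForm.ext_of_homog ((ListForm.ofRaw_homog _).pullback J) (ListForm.ofRaw_homog _) fun X => by
      rw [ListForm.pullback_apply, List.map_ofFn, hW, ListForm.ofRaw_ofFn, ListForm.ofRaw_ofFn]
      exact h11 X
  set C : ListForm g := -ListForm.pullback J (ListForm.diff W) with hC
  have pC : ListForm.parity C = -C := by
    rw [hC, map_neg, ListForm.parity_pullback, ListForm.parity_diff, pW, map_neg]
  have hpow : ∀ k, ListForm.ofRaw (wpow (fun v => ω v) k) = W ^ k := ListForm.ofRaw_wpow sW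
  have dcdW : ∀ {p : ℕ} {η : (Fin p → g) → ℂ} (k : ℕ), Even p → ListForm.ofRaw η = W ^ (k + 1) →
      ListForm.ofRaw (dcD J η) = ((k : ℂ) + 1) • (C * W ^ k) := by
    intro p η k hp hη
    rw [ListForm.ofRaw_dcD J (hη ▸ sW.pow _), hη, ListForm.pullback_pow, jW,
      ListForm.diff_pow_succ pW, map_smul, ListForm.pullback_mul, ListForm.pullback_pow, jW,
      hp.add_one.neg_one_pow, hC]
    simp
  have sdc : ∀ {p : ℕ} {η : (Fin p → g) → ℂ}, ListForm.SwapNeg (ListForm.ofRaw η) →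
      ListForm.NegArg (ListForm.ofRaw η) → ListForm.SwapNeg (ListForm.ofRaw (dcD J η)) ∧
      ListForm.NegArg (ListForm.ofRaw (dcD J η)) := by
    intro p η hs hn
    have hJn : ∀ x, J (-x) = -J x := fun x => map_neg J x
    rw [ListForm.ofRaw_dcD J hs]
    exact ⟨(((hs.pullback J).diff (hn.pullback hJn)).pullback J).smul _,
      ((hn.pullback hJn).diff.pullback hJn).smul _⟩
  have ddW : ∀ {p : ℕ} {η : (Fin p → g) → ℂ} (k : ℕ), Even p → ListForm.ofRaw η = W ^ (k + 1) →
      ListForm.SwapNeg (ListForm.ofRaw (ceD (dcD J η))) ∧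
      ListForm.ofRaw (ceD (dcD J η)) = ListForm.diff (((k : ℂ) + 1) • (C * W ^ k)) := by
    intro p η k hp hη
    obtain ⟨h1, h2⟩ := sdc (hη ▸ sW.pow (k + 1)) (hη ▸ nW.pow (k + 1))
    rw [ListForm.ofRaw_ceD h1, ← dcdW k hp hη]
    exact ⟨h1.diff h2, rfl⟩
  set A : ListForm g := ListForm.diff C * W ^ (n - 2) with hA
  set B : ListForm g := C * (ListForm.diff W * W ^ (n - 3)) with hB
  have expand : ∀ {p : ℕ} {η : (Fin p → g) → ℂ} (k : ℕ), k + 2 ≤ n → Even p →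
      ListForm.ofRaw η = W ^ (k + 1) →
      ListForm.ofRaw (ceD (dcD J η)) * W ^ (n - (k + 1) - 1)
        = ((k : ℂ) + 1) • A - (((k : ℂ) + 1) * k) • B := by
    intro p η k hk hp hη
    rw [(ddW k hp hη).2, ListForm.diff_diff_pow_mul_pow pW pC,
      show k + (n - (k + 1) - 1) = n - 2 by omega, show n - 2 - 1 = n - 3 by omega]
  have gauduchon : ∀ k, k + 2 ≤ n →
      ListForm.ofRaw (wedge (ceD (dcD J (wpow (fun v => ω v) (k + 1))))
        (wpow (fun v => ω v) (n - (k + 1) - 1)))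
      = ((k : ℂ) + 1) • A - (((k : ℂ) + 1) * k) • B := by
    intro k hk
    rw [ListForm.ofRaw_wedge (ddW k (even_two_mul _) (hpow _)).1 (by rw [hpow]; exact sW.pow _),
      hpow, expand k hk (even_two_mul _) (hpow _)]
  have reduced : ∀ k, k + 2 ≤ n →
      wedge (ceD (dcD J (wpow (fun v => ω v) (k + 1)))) (wpow (fun v => ω v) (n - (k + 1) - 1)) = 0 →
      A = (k : ℂ) • B := by
    intro k hk h
    have h0 := gauduchon k hk
    rw [(ListForm.ofRaw_eq_zero_iff _).2 h, mul_smul, ← smul_sub] at h0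
    exact sub_eq_zero.1 ((smul_eq_zero.1 h0.symm).resolve_left (Nat.cast_add_one_ne_zero k))
  obtain ⟨k₁, rfl⟩ := Nat.exists_eq_add_of_le' hk1
  obtain ⟨k₂, rfl⟩ := Nat.exists_eq_add_of_le' (hk1.trans hk12.le)
  have e1 := reduced k₁ (by omega) hG1
  have e2 := reduced k₂ (by omega) hG2
  have B0 : B = 0 := by
    have h : ((k₁ : ℂ) - k₂) • B = 0 := by rw [sub_smul, ← e1, ← e2, sub_self]
    refine (smul_eq_zero.1 h).resolve_left (sub_ne_zero.2 ?_)
    exact_mod_cast (show k₁ ≠ k₂ by omega)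
  have A0 : A = 0 := by rw [e1, B0, smul_zero]
  have hW1 : ListForm.ofRaw (fun v => ω v) = W ^ (0 + 1) := by simp [hW]
  refine ⟨fun k hk hkn => ?_, ?_, ?_, ?_⟩
  · obtain ⟨k, rfl⟩ := Nat.exists_eq_add_of_le' hk
    rw [← ListForm.ofRaw_eq_zero_iff, gauduchon k (by omega), A0, B0, smul_zero, smul_zero,
      sub_zero]
  · obtain ⟨m, rfl⟩ : ∃ m, n = m + 2 := ⟨n - 2, by omega⟩
    have h := expand (η := wpow (fun v => ω v) (m + 1)) m le_rfl (even_two_mul _) (hpow _)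
    rw [A0, B0, smul_zero, smul_zero, sub_zero, show m + 2 - (m + 1) - 1 = 0 by omega, pow_zero,
      mul_one] at h
    exact (ListForm.ofRaw_eq_zero_iff _).1 h
  · have h := expand 0 (by omega) even_two hW1
    rw [A0, B0, smul_zero, smul_zero, sub_zero, show n - (0 + 1) - 1 = n - 2 by omega] at h
    rw [← ListForm.ofRaw_eq_zero_iff,
      ListForm.ofRaw_wedge (ddW 0 even_two hW1).1 (by rw [hpow]; exact sW.pow _), hpow, h]
  · have hd : ListForm.ofRaw (ceD fun v => ω v) = ListForm.diff W := ListForm.ofRaw_ceD sW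
    have sd : ListForm.SwapNeg (ListForm.ofRaw (ceD fun v => ω v)) := hd ▸ sW.diff nW
    have sp : ListForm.SwapNeg (ListForm.ofRaw (wpow (fun v => ω v) (n - 3))) := by
      rw [hpow]; exact sW.pow _
    have hr := ListForm.ofRaw_wedge sd sp
    rw [← ListForm.ofRaw_eq_zero_iff,
      ListForm.ofRaw_wedge (sdc sW nW).1 (by rw [hr]; exact sd.mul sp), hr, hd, hpow,
      dcdW 0 even_two hW1]
    simpa [hB] using B0
end
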